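/- arXiv:2005.12432 — 3 statements merged into one kernel-verified Lean document; each statement's English description precedes it below -/
import Mathlib

section
/- Let N be an even positive integer with N ≥ 4, let ν be the least positive root of U'_{N+1}(x), and for k = 1,…,N let z_k = (−1)^{k−1}( U_{k−1}(ν)U_k(ν) − U_{N−k}(ν)U_{N−k+1}(ν) + ((N+1−2k)/(N+1)) U_N(ν)U_{N+1}(ν) ). Set β² = ∑_{j=1}^N z_j² − ∑_{j=1}^{N−2} z_j z_{j+2}, and define α_k = ( ∑_{j=1}^{N−k+1} z_j z_{j+k−1} − ∑_{j=1}^{N−k−1} z_j z_{j+k+1} )/β² for k = 1,…,N−2, α_{N−1} = (z_1 z_{N−1} + z_2 z_N)/β², and α_N = z_1 z_N / β². Then α_1 = 1, the sine polynomial ∑_{j=1}^N α_j sin(jt) is nonnegative for all t ∈ [0, π], and ∑_{j=1}^N α_j = 1/(4ν²); i.e., (α_1,…,α_N) is an extremal vector for the problem of maximizing ∑_{j=1}^N α_j over S_N. -/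
/-- Evaluation of the Chebyshev polynomial of the second kind. -/
noncomputable def Ucheb (n : ℤ) (x : ℝ) : ℝ := (Polynomial.Chebyshev.U ℝ n).eval x

/-- Evaluation of the derivative of the Chebyshev polynomial of the second kind. -/
noncomputable def Ucheb' (n : ℤ) (x : ℝ) : ℝ :=
  (Polynomial.derivative (Polynomial.Chebyshev.U ℝ n)).eval x

/-- The k-th coordinate (1-based) of the vector Z(x). -/
noncomputable def zCoord (N k : ℕ) (x : ℝ) : ℝ :=
  (-1 : ℝ) ^ (k - 1) *
    (Ucheb ((k : ℤ) - 1) x * Ucheb (k : ℤ) x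
      - Ucheb ((N : ℤ) - k) x * Ucheb ((N : ℤ) - k + 1) x
      + (((N : ℝ) + 1 - 2 * k) / ((N : ℝ) + 1)) * Ucheb (N : ℤ) x * Ucheb ((N : ℤ) + 1) x)

/-- The autocorrelation at lag `k` of the finite sequence `z 1, …, z N`. -/
def lagSum (z : ℕ → ℝ) (N k : ℕ) : ℝ := ∑ j ∈ Finset.Icc 1 (N - k), z j * z (j + k)

lemma lagSum_of_le {z : ℕ → ℝ} {N k : ℕ} (h : N ≤ k) : lagSum z N k = 0 := by
  simp [lagSum, Nat.sub_eq_zero_of_le h]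

lemma lagSum_succ (z : ℕ → ℝ) {N k : ℕ} (h : k ≤ N) :
    lagSum z (N + 1) k = lagSum z N k + z (N + 1 - k) * z (N + 1) := by
  unfold lagSum
  rw [show N + 1 - k = N - k + 1 by omega, Finset.sum_Icc_succ_top (by omega),
    show N - k + 1 + k = N + 1 by omega]

lemma sum_sub_lag_two_mul_sin (c : ℕ → ℝ) (t : ℝ) (M : ℕ) :
    ∑ k ∈ Finset.Icc 1 M, (c (k - 1) - c (k + 1)) * Real.sin (k * t) =
      Real.sin t * (c 0 + 2 * ∑ k ∈ Finset.Icc 1 M, c k * Real.cos (k * t))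
        - c M * Real.sin ((M + 1) * t) - c (M + 1) * Real.sin (M * t) := by
  induction M with
  | zero => simp; ring
  | succ M ih =>
    rw [Finset.sum_Icc_succ_top (by omega), Finset.sum_Icc_succ_top (by omega), ih]
    push_cast
    have e1 : (M : ℝ) * t = (M + 1) * t - t := by ring
    have e2 : ((M : ℝ) + 1 + 1) * t = (M + 1) * t + t := by ring
    rw [e2, e1, Real.sin_add, Real.sin_sub]
    ring

lemma sum_sub_lag_two (c : ℕ → ℝ) (M : ℕ) :
    ∑ k ∈ Finset.Icc 1 M, (c (k - 1) - c (k + 1)) = c 0 + c 1 - c M - c (M + 1) := by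
  induction M with
  | zero => simp
  | succ M ih =>
    rw [Finset.sum_Icc_succ_top (by omega), ih, Nat.add_sub_cancel]
    ring

lemma sq_sum_cos_add_sq_sum_sin (z : ℕ → ℝ) (t : ℝ) (N : ℕ) :
    (∑ j ∈ Finset.Icc 1 N, z j * Real.cos (j * t)) ^ 2
        + (∑ j ∈ Finset.Icc 1 N, z j * Real.sin (j * t)) ^ 2 =
      lagSum z N 0 + 2 * ∑ k ∈ Finset.Icc 1 N, lagSum z N k * Real.cos (k * t) := by
  induction N with
  | zero => simp [lagSum]
  | succ N ih =>
    have hlag : ∑ k ∈ Finset.Icc 1 (N + 1), lagSum z (N + 1) k * Real.cos (k * t) =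
        ∑ k ∈ Finset.Icc 1 N, lagSum z N k * Real.cos (k * t)
          + z (N + 1) * ∑ k ∈ Finset.Icc 1 N, z (N + 1 - k) * Real.cos (k * t) := by
      rw [Finset.sum_Icc_succ_top (by omega), lagSum_of_le le_rfl, Finset.mul_sum,
        ← Finset.sum_add_distrib, zero_mul, add_zero]
      refine Finset.sum_congr rfl fun k hk => ?_
      rw [lagSum_succ z (Finset.mem_Icc.1 hk).2]
      ring
    have hrefl : ∑ k ∈ Finset.Icc 1 N, z (N + 1 - k) * Real.cos (k * t) =
        ∑ j ∈ Finset.Icc 1 N, (z j * Real.cos (j * t) * Real.cos ((N + 1 : ℕ) * t)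
          + z j * Real.sin (j * t) * Real.sin ((N + 1 : ℕ) * t)) := by
      refine Finset.sum_nbij' (fun k => N + 1 - k) (fun k => N + 1 - k) ?_ ?_ ?_ ?_ ?_
      · intro k hk; rw [Finset.mem_Icc] at *; omega
      · intro k hk; rw [Finset.mem_Icc] at *; omega
      · intro k hk; rw [Finset.mem_Icc] at *; omega
      · intro k hk; rw [Finset.mem_Icc] at *; omega
      · intro k hk
        rw [Finset.mem_Icc] at hk
        have hcast : (k : ℝ) * t = (N + 1 : ℕ) * t - (N + 1 - k : ℕ) * t := by
          rw [Nat.cast_sub (by omega)]; ring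
        rw [hcast, Real.cos_sub]
        ring
    rw [Finset.sum_Icc_succ_top (by omega), Finset.sum_Icc_succ_top (by omega), hlag, hrefl,
      lagSum_succ z (Nat.zero_le N), Finset.sum_add_distrib, ← Finset.sum_mul, ← Finset.sum_mul,
      Nat.sub_zero]
    linear_combination ih + z (N + 1) ^ 2 * Real.sin_sq_add_cos_sq ((N + 1 : ℕ) * t)

lemma sum_lagSum_mul_sin (z : ℕ → ℝ) (N : ℕ) (t : ℝ) :
    ∑ k ∈ Finset.Icc 1 N, (lagSum z N (k - 1) - lagSum z N (k + 1)) * Real.sin (k * t) =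
      Real.sin t * ((∑ j ∈ Finset.Icc 1 N, z j * Real.cos (j * t)) ^ 2
        + (∑ j ∈ Finset.Icc 1 N, z j * Real.sin (j * t)) ^ 2) := by
  rw [sum_sub_lag_two_mul_sin, sq_sum_cos_add_sq_sum_sin, lagSum_of_le le_rfl,
    lagSum_of_le N.le_succ]
  ring

lemma lagSum_zero_sub_lagSum_two_pos {z : ℕ → ℝ} {N : ℕ} (hN : 2 ≤ N) (hz : z 1 ≠ 0) :
    0 < lagSum z N 0 - lagSum z N 2 := by
  obtain ⟨M, rfl⟩ : ∃ M, N = M + 2 := ⟨N - 2, by omega⟩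
  have key : ∀ M : ℕ, 2 * (lagSum z (M + 2) 0 - lagSum z (M + 2) 2) =
      ∑ j ∈ Finset.Icc 1 M, (z j - z (j + 2)) ^ 2
        + z 1 ^ 2 + z 2 ^ 2 + z (M + 1) ^ 2 + z (M + 2) ^ 2 := by
    intro M
    induction M with
    | zero => simp [lagSum, Finset.sum_Icc_succ_top]; ring
    | succ M ih =>
      rw [lagSum_succ z (by omega : 0 ≤ M + 2), lagSum_succ z (by omega : 2 ≤ M + 2),
        Finset.sum_Icc_succ_top (by omega), show M + 2 + 1 - 2 = M + 1 by omega, Nat.sub_zero]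
      linear_combination ih
  have h1 : 0 < z 1 ^ 2 := by positivity
  have h2 : 0 ≤ ∑ j ∈ Finset.Icc 1 M, (z j - z (j + 2)) ^ 2 :=
    Finset.sum_nonneg fun _ _ => sq_nonneg _
  nlinarith [key M, sq_nonneg (z 2), sq_nonneg (z (M + 1)), sq_nonneg (z (M + 2))]

lemma sum_range_shift {f : ℕ → ℝ} {N : ℕ} (h0 : f 0 = 0) (hN : f N = 0) :
    ∑ i ∈ Finset.range N, f i = ∑ i ∈ Finset.range N, f (i + 1) := by
  have h := (Finset.sum_range_succ f N).symm.trans (Finset.sum_range_succ' f N)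
  simpa [h0, hN] using h

/-- The quadratic form of the pentadiagonal Toeplitz matrix vanishes on its kernel. -/
lemma toeplitz_form_eq_zero {w : ℕ → ℝ} {N : ℕ} {a b c : ℝ}
    (h0 : w 0 = 0) (h1 : w 1 = 0) (h2 : w (N + 2) = 0) (h3 : w (N + 3) = 0)
    (hrec : ∀ i < N, a * w (i + 2) + b * (w (i + 1) + w (i + 3)) + c * (w i + w (i + 4)) = 0) :
    a * lagSum (fun k => w (k + 1)) N 0 + 2 * b * lagSum (fun k => w (k + 1)) N 1
      + 2 * c * lagSum (fun k => w (k + 1)) N 2 = 0 := by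
  have hlag : ∀ k ≤ 2, lagSum (fun k => w (k + 1)) N k =
      ∑ i ∈ Finset.range N, w (i + 2) * w (i + 2 + k) := by
    intro k hk
    have h : ∀ M, ∑ j ∈ Finset.Icc 1 M, w (j + 1) * w (j + k + 1) =
        ∑ i ∈ Finset.range M, w (i + 2) * w (i + 2 + k) := by
      intro M
      rw [Finset.range_eq_Ico, Finset.sum_Ico_eq_sum_range, ← Finset.Ico_add_one_right_eq_Icc,
        Finset.sum_Ico_eq_sum_range]
      refine Finset.sum_congr (by simp) fun i _ => ?_
      ring_nf
    rw [lagSum, h]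
    refine Finset.sum_subset (Finset.range_mono (Nat.sub_le N k)) fun i hi hi' => ?_
    rw [Finset.mem_range] at hi hi'
    have : i + 2 + k = N + 2 ∨ i + 2 + k = N + 3 := by omega
    rcases this with h | h <;> simp [h, h2, h3]
  have s1 : ∑ i ∈ Finset.range N, w (i + 1) * w (i + 2) =
      ∑ i ∈ Finset.range N, w (i + 2) * w (i + 3) :=
    sum_range_shift (f := fun i => w (i + 1) * w (i + 2)) (by simp [h1]) (by simp [h2])
  have s2 : ∑ i ∈ Finset.range N, w i * w (i + 2) =
      ∑ i ∈ Finset.range N, w (i + 2) * w (i + 4) :=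
    (sum_range_shift (f := fun i => w i * w (i + 2)) (by simp [h0]) (by simp [h2])).trans
      (sum_range_shift (f := fun i => w (i + 1) * w (i + 3)) (by simp [h1]) (by simp [h3]))
  rw [hlag 0 (by omega), hlag 1 (by omega), hlag 2 (by omega)]
  have := Finset.sum_eq_zero (s := Finset.range N)
    (f := fun i => w (i + 2) * (a * w (i + 2) + b * (w (i + 1) + w (i + 3))
      + c * (w i + w (i + 4)))) fun i hi => by
    rw [hrec i (Finset.mem_range.1 hi), mul_zero]
  rw [← this]
  have e : ∀ i, w (i + 2) * (a * w (i + 2) + b * (w (i + 1) + w (i + 3))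
      + c * (w i + w (i + 4))) = a * (w (i + 2) * w (i + 2 + 0)) + b * (w (i + 1) * w (i + 2))
        + b * (w (i + 2) * w (i + 3)) + c * (w i * w (i + 2)) + c * (w (i + 2) * w (i + 4)) := by
    intro i
    ring
  simp only [e, Finset.sum_add_distrib, ← Finset.mul_sum]
  rw [s1, s2]
  simp only [add_assoc, Nat.reduceAdd]
  ring

lemma Ucheb_add_one (n : ℤ) (x : ℝ) : Ucheb (n + 1) x = 2 * x * Ucheb n x - Ucheb (n - 1) x := by
  simp [Ucheb, Polynomial.Chebyshev.U_add_one ℝ n]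

lemma Ucheb_sq_add_sq (n : ℕ) (x : ℝ) :
    Ucheb n x ^ 2 + Ucheb (n + 1) x ^ 2 - 2 * x * Ucheb n x * Ucheb (n + 1) x = 1 := by
  induction n with
  | zero => simp [Ucheb]; ring
  | succ n ih =>
    have h := Ucheb_add_one ((n : ℤ) + 1) x
    rw [add_sub_cancel_right] at h
    push_cast
    rw [h]
    linear_combination ih

lemma one_sub_X_sq_mul_derivative_U (n : ℤ) :
    2 * ((1 - Polynomial.X ^ 2) * Polynomial.derivative (Polynomial.Chebyshev.U ℝ n)) =
      ((n : Polynomial ℝ) + 2) * Polynomial.Chebyshev.U ℝ (n - 1)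
        - (n : Polynomial ℝ) * Polynomial.Chebyshev.U ℝ (n + 1) := by
  have h1 := Polynomial.Chebyshev.add_one_mul_T_eq_poly_in_U (R := ℝ) n
  have h2 := Polynomial.Chebyshev.T_eq_U_sub_X_mul_U ℝ (n + 1)
  have h3 := Polynomial.Chebyshev.U_add_one ℝ n
  rw [add_sub_cancel_right] at h2
  rw [h2] at h1
  linear_combination 2 * h1 - ((n : Polynomial ℝ) + 2) * h3

lemma one_sub_sq_mul_Ucheb' (n : ℤ) (x : ℝ) :
    2 * ((1 - x ^ 2) * Ucheb' n x) = (n + 2) * Ucheb (n - 1) x - n * Ucheb (n + 1) x := by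
  have h := congrArg (Polynomial.eval x) (one_sub_X_sq_mul_derivative_U n)
  simpa [Ucheb, Ucheb'] using h

/-- The unsigned coordinates of `Z(x)`, indexed by all integers. -/
noncomputable def unsignedZ (N : ℕ) (x : ℝ) (k : ℤ) : ℝ :=
  Ucheb (k - 1) x * Ucheb k x - Ucheb (N - k) x * Ucheb (N - k + 1) x
    + ((N + 1 - 2 * k) / (N + 1)) * Ucheb N x * Ucheb (N + 1) x

lemma Ucheb_mul_Ucheb_rec (k : ℤ) (x : ℝ) :
    (1 - 4 * x ^ 2) * (Ucheb (k - 1) x * Ucheb k x)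
      + 2 * x ^ 2 * (Ucheb (k - 2) x * Ucheb (k - 1) x + Ucheb k x * Ucheb (k + 1) x)
      = (Ucheb (k - 3) x * Ucheb (k - 2) x + Ucheb (k + 1) x * Ucheb (k + 2) x) / 2 := by
  have e1 := Ucheb_add_one k x
  have e2 := Ucheb_add_one (k + 1) x
  have e3 := Ucheb_add_one (k - 1) x
  have e4 := Ucheb_add_one (k - 2) x
  ring_nf at e1 e2 e3 e4 ⊢
  have e3' : Ucheb (-2 + k) x = 2 * x * Ucheb (-1 + k) x - Ucheb k x := by linarith
  have e4' : Ucheb (-3 + k) x = 2 * x * Ucheb (-2 + k) x - Ucheb (-1 + k) x := by linarith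
  rw [e4', e3', e2, e1]
  ring

lemma unsignedZ_rec (N : ℕ) (x : ℝ) (k : ℤ) :
    (1 - 4 * x ^ 2) * unsignedZ N x k + 2 * x ^ 2 * (unsignedZ N x (k - 1) + unsignedZ N x (k + 1))
      = (unsignedZ N x (k - 2) + unsignedZ N x (k + 2)) / 2 := by
  have h1 := Ucheb_mul_Ucheb_rec k x
  have h2 := Ucheb_mul_Ucheb_rec (N + 1 - k) x
  unfold unsignedZ
  push_cast
  ring_nf at h1 h2 ⊢
  linear_combination h1 - h2

lemma unsignedZ_reflect (N : ℕ) (x : ℝ) (k : ℤ) :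
    unsignedZ N x (N + 1 - k) = -unsignedZ N x k := by
  unfold unsignedZ
  have hN : (N : ℝ) + 1 ≠ 0 := by positivity
  push_cast
  field_simp
  ring_nf

lemma unsignedZ_zero (N : ℕ) (x : ℝ) : unsignedZ N x 0 = 0 := by
  have hN : (N : ℝ) + 1 ≠ 0 := by positivity
  have h : Ucheb (-1) x = 0 := by simp [Ucheb]
  simp [unsignedZ, h, hN]

lemma Ucheb_add_two_of_root {N : ℕ} {x : ℝ} (hx : Ucheb' (N + 1) x = 0) :
    (N + 1) * Ucheb (N + 2) x = (N + 3) * Ucheb N x := by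
  have h := one_sub_sq_mul_Ucheb' (N + 1) x
  rw [hx] at h
  push_cast at h
  rw [add_sub_cancel_right, show (N : ℤ) + 1 + 1 = N + 2 by ring] at h
  linarith

lemma unsignedZ_neg_one {N : ℕ} {x : ℝ} (hx : Ucheb' (N + 1) x = 0) :
    unsignedZ N x (-1) = 0 := by
  have hN : (N : ℝ) + 1 ≠ 0 := by positivity
  have h : Ucheb (-1) x = 0 := by simp [Ucheb]
  have h2 := Ucheb_add_two_of_root hx
  unfold unsignedZ
  rw [h, show (N : ℤ) - (-1) = N + 1 by ring, show (N : ℤ) + 1 + 1 = N + 2 by ring]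
  push_cast
  field_simp
  linear_combination (-Ucheb (N + 1) x) * h2

lemma unsignedZ_one_pos {N : ℕ} {x : ℝ} (h0 : 0 < x) (h1 : x < 1) (hx : Ucheb' (N + 1) x = 0) :
    0 < unsignedZ N x 1 := by
  have h2 := Ucheb_add_two_of_root hx
  have h3 := Ucheb_add_one ((N : ℤ) + 1) x
  have h4 := Ucheb_add_one N x
  have h5 := Ucheb_sq_add_sq N x
  rw [add_sub_cancel_right, show (N : ℤ) + 1 + 1 = N + 2 by ring] at h3
  have u0 : Ucheb (1 - 1) x = 1 := by simp [Ucheb]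
  have u1 : Ucheb 1 x = 2 * x := by simp [Ucheb]
  have hn : 0 < (N : ℝ) + 1 := by positivity
  have hY : unsignedZ N x 1 = 2 * x - (2 * x * Ucheb N x - Ucheb (N + 1) x) * Ucheb N x
      + (N - 1) / (N + 1) * Ucheb N x * Ucheb (N + 1) x := by
    unfold unsignedZ
    rw [u0, u1, show (N : ℤ) - 1 + 1 = N by ring,
      show Ucheb (N - 1) x = 2 * x * Ucheb N x - Ucheb (N + 1) x by linarith]
    push_cast
    ring
  set a := Ucheb N x
  set b := Ucheb (N + 1) x
  rw [h3] at h2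
  have hb : x * (N + 1) * b = (N + 2) * a := by linear_combination h2 / 2
  have hb' : b = (N + 2) * a / (x * (N + 1)) := by field_simp; linear_combination hb
  have ha : a ≠ 0 := by
    intro ha
    rw [hb', ha] at h5
    simp at h5
  have key : x * ((N : ℝ) + 1) * unsignedZ N x 1 = 4 * (N + 2) * (1 - x ^ 2) * a ^ 2 := by
    rw [hY]
    rw [hb'] at h5 ⊢
    field_simp at h5 ⊢
    linear_combination (-2) * h5
  have : 0 < x * ((N : ℝ) + 1) * unsignedZ N x 1 := by
    rw [key]
    have : 0 < 1 - x ^ 2 := by nlinarith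
    positivity
  exact (pos_iff_pos_of_mul_pos this).1 (by positivity)

section Quadrature

open Polynomial
open Polynomial.Chebyshev hiding C S

/-- Integration against the weight `√(1 - x²)` on `[-1, 1]`, in the variable `x = cos φ`. -/
noncomputable def sqrtWeightIntegral : ℝ[X] →ₗ[ℝ] ℝ where
  toFun f := ∫ φ in (0 : ℝ)..Real.pi, f.eval (Real.cos φ) * Real.sin φ ^ 2
  map_add' f g := by
    simp only [eval_add, add_mul]
    exact intervalIntegral.integral_add (Continuous.intervalIntegrable (by fun_prop) _ _)
      (Continuous.intervalIntegrable (by fun_prop) _ _)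
  map_smul' c f := by
    simp only [eval_smul, smul_eq_mul, mul_assoc, RingHom.id_apply]
    exact intervalIntegral.integral_const_mul _ _

lemma sqrtWeightIntegral_nonneg {f : ℝ[X]} (hf : ∀ x ∈ Set.Icc (-1 : ℝ) 1, 0 ≤ f.eval x) :
    0 ≤ sqrtWeightIntegral f :=
  intervalIntegral.integral_nonneg Real.pi_pos.le fun φ _ =>
    mul_nonneg (hf _ ⟨Real.neg_one_le_cos φ, Real.cos_le_one φ⟩) (sq_nonneg _)

lemma sqrtWeightIntegral_one_pos : 0 < sqrtWeightIntegral 1 := by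
  have : sqrtWeightIntegral 1 = Real.pi / 2 := by
    simp [sqrtWeightIntegral, integral_sin_sq]
  rw [this]
  positivity

lemma sqrtWeightIntegral_U {m : ℕ} (hm : m ≠ 0) : sqrtWeightIntegral (U ℝ m) = 0 := by
  have hm' : (m : ℝ) ≠ 0 := by exact_mod_cast hm
  have hm2 : (m : ℝ) + 2 ≠ 0 := by positivity
  have hd : ∀ φ : ℝ, HasDerivAt
      (fun φ : ℝ => Real.sin (m * φ) / (2 * m) - Real.sin ((m + 2) * φ) / (2 * (m + 2)))
      ((U ℝ m).eval (Real.cos φ) * Real.sin φ ^ 2) φ := by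
    intro φ
    have h1 : HasDerivAt (fun φ : ℝ => Real.sin (m * φ)) (Real.cos (m * φ) * (m * 1)) φ :=
      ((hasDerivAt_id' φ).const_mul (m : ℝ)).sin
    have h2 : HasDerivAt (fun φ : ℝ => Real.sin ((m + 2) * φ))
        (Real.cos ((m + 2) * φ) * ((m + 2) * 1)) φ :=
      ((hasDerivAt_id' φ).const_mul ((m : ℝ) + 2)).sin
    refine ((h1.div_const (2 * (m : ℝ))).sub (h2.div_const (2 * ((m : ℝ) + 2)))).congr_deriv ?_
    have hU := U_real_cos φ (m : ℤ)
    push_cast at hU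
    rw [pow_two, ← mul_assoc (eval _ _), hU, show (m : ℝ) * φ = (m + 1) * φ - φ by ring,
      show ((m : ℝ) + 2) * φ = (m + 1) * φ + φ by ring, Real.cos_add, Real.cos_sub]
    field_simp
    ring
  have h := intervalIntegral.integral_eq_sub_of_hasDerivAt (a := 0) (b := Real.pi)
    (fun φ _ => hd φ) (Continuous.intervalIntegrable (by fun_prop) _ _)
  have hs : Real.sin (((m : ℝ) + 2) * Real.pi) = 0 := by
    exact_mod_cast Real.sin_nat_mul_pi (m + 2)
  exact h.trans (by simp [hs, Real.sin_nat_mul_pi])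

lemma X_mul_U (m : ℤ) : X * U ℝ m = C (1 / 2) * (U ℝ (m + 1) + U ℝ (m - 1)) := by
  have h2 : (C (1 / 2) : ℝ[X]) * 2 = 1 := by
    rw [← map_ofNat C 2, ← map_mul]; norm_num
  rw [U_add_one]
  linear_combination (-X * U ℝ m) * h2

lemma sqrtWeightIntegral_C_mul (c : ℝ) (f : ℝ[X]) :
    sqrtWeightIntegral (C c * f) = c * sqrtWeightIntegral f := by
  rw [← smul_eq_C_mul, map_smul, smul_eq_mul]

lemma sqrtWeightIntegral_X_pow_mul_U (k : ℕ) :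
    ∀ m : ℕ, k < m → sqrtWeightIntegral (X ^ k * U ℝ m) = 0 := by
  induction k with
  | zero => intro m hm; simpa using sqrtWeightIntegral_U (by omega)
  | succ k ih =>
    intro m hm
    obtain ⟨m, rfl⟩ : ∃ n, m = n + 1 := ⟨m - 1, by omega⟩
    have h1 := ih (m + 2) (by omega)
    have h2 := ih m (by omega)
    push_cast at h1
    have : X ^ (k + 1) * U ℝ (m + 1 : ℕ) =
        C (1 / 2) * (X ^ k * U ℝ (m + 2) + X ^ k * U ℝ m) := by
      have := X_mul_U ((m : ℤ) + 1)
      rw [add_sub_cancel_right, show (m : ℤ) + 1 + 1 = m + 2 by ring] at this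
      push_cast
      linear_combination X ^ k * this
    rw [this, sqrtWeightIntegral_C_mul, map_add, h1, h2]
    simp

lemma sqrtWeightIntegral_mul_U {q : ℝ[X]} {m : ℕ} (h : q.natDegree < m) :
    sqrtWeightIntegral (q * U ℝ m) = 0 := by
  rw [q.as_sum_range_C_mul_X_pow, Finset.sum_mul, map_sum]
  refine Finset.sum_eq_zero fun i hi => ?_
  rw [mul_assoc, sqrtWeightIntegral_C_mul, sqrtWeightIntegral_X_pow_mul_U, mul_zero]
  rw [Finset.mem_range] at hi
  omega

/-- The node polynomial of the Gauss–Lobatto quadrature for `√(1 - x²)`. -/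
noncomputable def lobattoPoly (N : ℕ) : ℝ[X] := (1 - X ^ 2) * derivative (U ℝ (N + 1))

lemma sqrtWeightIntegral_mul_lobattoPoly {q : ℝ[X]} {N : ℕ} (h : q.natDegree < N) :
    sqrtWeightIntegral (lobattoPoly N * q) = 0 := by
  have h1 := sqrtWeightIntegral_mul_U h
  have h2 := sqrtWeightIntegral_mul_U (m := N + 2) (q := q) (by omega)
  have hW := one_sub_X_sq_mul_derivative_U (N + 1)
  rw [add_sub_cancel_right, show (N : ℤ) + 1 + 1 = (N + 2 : ℕ) by push_cast; ring] at hW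
  have h3 : C 2 * (lobattoPoly N * q) =
      C ((N : ℝ) + 3) * (q * U ℝ N) - C ((N : ℝ) + 1) * (q * U ℝ (N + 2 : ℕ)) := by
    simp only [map_add, map_natCast, map_ofNat, map_one]
    unfold lobattoPoly
    push_cast at hW ⊢
    linear_combination q * hW
  have h4 := congrArg sqrtWeightIntegral h3
  rw [map_sub, sqrtWeightIntegral_C_mul, sqrtWeightIntegral_C_mul, sqrtWeightIntegral_C_mul, h1,
    h2] at h4
  linarith

lemma natDegree_derivative_U (N : ℕ) : (derivative (U ℝ (N + 1))).natDegree = N := by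
  have h := natDegree_U_natCast ℝ (N + 1)
  push_cast at h
  rw [natDegree_derivative, h, Nat.add_sub_cancel]

lemma natDegree_lobattoPoly (N : ℕ) : (lobattoPoly N).natDegree = N + 2 := by
  have h2 : (1 - X ^ 2 : ℝ[X]).natDegree = 2 := by compute_degree!
  have h1 : derivative (U ℝ (N + 1)) ≠ 0 := by
    intro h0
    have h := natDegree_U_natCast ℝ (N + 1)
    push_cast at h
    rw [derivative_eq_zero.1 h0] at h
    omega
  rw [lobattoPoly, natDegree_mul (by rintro h; simp [h] at h2) h1, natDegree_derivative_U, h2]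
  ring

/-- If the node polynomial has `N + 2` distinct roots, then polynomials of degree at most
`2 * N + 1` that vanish at all of them have integral zero. -/
lemma sqrtWeightIntegral_eq_zero_of_nodes {N : ℕ} (hN : N ≠ 0) {S : Finset ℝ}
    (hS : S.card = N + 2)
    (hroot : ∀ s ∈ S, (lobattoPoly N).eval s = 0) {R : ℝ[X]} (hR : R.natDegree ≤ 2 * N + 1)
    (hRS : ∀ s ∈ S, R.eval s = 0) : sqrtWeightIntegral R = 0 := by
  have hdiv := EuclideanDomain.div_add_mod R (lobattoPoly N)
  have hW := natDegree_lobattoPoly N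
  have hmod : R % lobattoPoly N = 0 := by
    refine eq_zero_of_natDegree_lt_card_of_eval_eq_zero' _ S (fun s hs => ?_) ?_
    · have := congrArg (eval s) hdiv
      simpa [hroot s hs, hRS s hs] using this
    · rw [hS, ← hW]
      exact natDegree_mod_lt R (by omega)
  rw [hmod, add_zero] at hdiv
  rw [← hdiv]
  apply sqrtWeightIntegral_mul_lobattoPoly
  rcases eq_or_ne (R / lobattoPoly N) 0 with hq | hq
  · rw [hq, natDegree_zero]
    omega
  · have := congrArg natDegree hdiv
    rw [natDegree_mul (by intro h; simp [h] at hW) hq, hW] at this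
    omega

/-- The Gauss–Lobatto quadrature has nonnegative weights. -/
lemma sqrtWeightIntegral_nonneg_of_nodes {N : ℕ} (hN : N ≠ 0) {S : Finset ℝ}
    (hS : S.card = N + 2)
    (hroot : ∀ s ∈ S, (lobattoPoly N).eval s = 0) {R : ℝ[X]} (hR : R.natDegree ≤ 2 * N + 1)
    (hRS : ∀ s ∈ S, 0 ≤ R.eval s)
    (hM : ∀ s ∈ S, ∃ M : ℝ[X], M.natDegree ≤ 2 * N + 1 ∧ 0 < M.eval s ∧
      (∀ s' ∈ S, s' ≠ s → M.eval s' = 0) ∧ ∀ x ∈ Set.Icc (-1 : ℝ) 1, 0 ≤ M.eval x) :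
    0 ≤ sqrtWeightIntegral R := by
  choose! M hMdeg hMpos hMzero hMnonneg using hM
  have h := sqrtWeightIntegral_eq_zero_of_nodes hN hS hroot
    (R := R - ∑ s ∈ S, C (R.eval s / (M s).eval s) * M s) ?_ ?_
  · rw [map_sub, map_sum, sub_eq_zero] at h
    rw [h]
    refine Finset.sum_nonneg fun s hs => ?_
    rw [sqrtWeightIntegral_C_mul]
    exact mul_nonneg (div_nonneg (hRS s hs) (hMpos s hs).le)
      (sqrtWeightIntegral_nonneg (hMnonneg s hs))
  · refine (natDegree_sub_le_of_le hR (natDegree_sum_le_of_forall_le S _ fun s hs => ?_)).trans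
      (max_self _).le
    exact (natDegree_C_mul_le _ _).trans (hMdeg s hs)
  · intro s hs
    rw [eval_sub, eval_finsetSum, Finset.sum_eq_single_of_mem s hs]
    · rw [eval_mul, eval_C, div_mul_cancel₀ _ (hMpos s hs).ne', sub_self]
    · intro s' hs' hne
      rw [eval_mul, hMzero s' hs' s hs hne.symm, mul_zero]

lemma Ucheb'_pos {x : ℝ} (hx : 1 ≤ x) (n : ℕ) : 0 < Ucheb' (n + 1) x := by
  have hrec : ∀ k : ℕ, Ucheb' (k + 2) x =
      2 * Ucheb (k + 1) x + 2 * x * Ucheb' (k + 1) x - Ucheb' k x := by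
    intro k
    simp [Ucheb, Ucheb', U_add_two]
  have key : ∀ k : ℕ, 0 < Ucheb k x ∧ Ucheb k x ≤ Ucheb (k + 1) x ∧ 0 ≤ Ucheb' k x ∧
      Ucheb' k x ≤ Ucheb' (k + 1) x ∧ 0 < Ucheb' (k + 1) x := by
    intro k
    induction k with
    | zero => simp [Ucheb, Ucheb']; linarith
    | succ k ih =>
      obtain ⟨h1, h2, h3, h4, h5⟩ := ih
      have e1 := Ucheb_add_one ((k : ℤ) + 1) x
      have e2 := hrec k
      rw [add_sub_cancel_right, show (k : ℤ) + 1 + 1 = k + 2 by ring] at e1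
      push_cast
      rw [show (k : ℤ) + 1 + 1 = k + 2 by ring]
      have h6 : Ucheb' (k + 1) x ≤ Ucheb' (k + 2) x := by
        rw [e2]; nlinarith
      refine ⟨by linarith, ?_, h5.le, h6, by linarith⟩
      rw [e1]; nlinarith
  exact (key n).2.2.2.2

lemma Ucheb'_neg {N : ℕ} (hN : Even N) (x : ℝ) : Ucheb' (N + 1) (-x) = Ucheb' (N + 1) x := by
  have h : (U ℝ (N + 1)).comp (-X) = -U ℝ (N + 1) := by
    refine funext fun y => ?_
    have := U_eval_neg ℝ (N + 1) y
    have hodd : Odd ((N + 1 : ℕ) : ℤ) := by exact_mod_cast hN.add_one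
    rw [Int.negOnePow_odd _ hodd] at this
    push_cast at this
    simpa using this
  have h' := congrArg (eval x) (congrArg derivative h)
  simpa [derivative_comp, Ucheb'] using h'

lemma abs_lt_one_of_root {N : ℕ} (hN : Even N) {x : ℝ} (hx : Ucheb' (N + 1) x = 0) : |x| < 1 := by
  by_contra! h
  have h1 := Ucheb'_pos h N
  rcases abs_choice x with h2 | h2 <;> rw [h2] at h1
  · exact h1.ne' hx
  · rw [Ucheb'_neg hN] at h1
    exact h1.ne' hx

lemma Ucheb'_zero_ne_zero {N : ℕ} (hN : Even N) : Ucheb' (N + 1) 0 ≠ 0 := by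
  intro h
  have h2 := Ucheb_add_two_of_root h
  have h3 := Ucheb_add_one ((N : ℤ) + 1) 0
  rw [add_sub_cancel_right, show (N : ℤ) + 1 + 1 = N + 2 by ring] at h3
  have h4 := Ucheb_sq_add_sq N 0
  have h5 : Ucheb (N + 1) 0 = 0 := U_eval_zero_of_odd ℝ (by exact_mod_cast hN.add_one)
  rw [h3, h5] at h2
  have h6 : (2 * (N : ℝ) + 4) * Ucheb N 0 = 0 := by linarith
  rcases mul_eq_zero.1 h6 with h7 | h7
  · have : (0 : ℝ) < 2 * (N : ℝ) + 4 := by positivity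
    exact this.ne' h7
  · simp [h5, h7] at h4

lemma card_roots_derivative_U (N : ℕ) :
    (derivative (U ℝ (N + 1))).roots.toFinset.card = N := by
  apply le_antisymm
  · exact (Multiset.toFinset_card_le _).trans
      ((card_roots' _).trans (natDegree_derivative_U N).le)
  · have h := card_roots_toFinset_le_derivative (U ℝ (N + 1))
    have hr := roots_U_real (N + 1)
    push_cast at hr
    have hc : (U ℝ (N + 1)).roots.toFinset.card = N + 1 := by
      have hnd := roots_U_real_nodup (N + 1)
      rw [hr, Finset.val_toFinset, Finset.card_image_of_injOn, Finset.card_range]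
      have := (Finset.range (N + 1)).nodup_map_iff_injOn.mp hnd
      push_cast at this
      simpa using this
    omega

/-- The Gauss–Lobatto nodes. -/
noncomputable def lobattoNodes (N : ℕ) : Finset ℝ :=
  insert 1 (insert (-1) (derivative (U ℝ (N + 1))).roots.toFinset)

lemma mem_lobattoNodes {N : ℕ} {s : ℝ} :
    s ∈ lobattoNodes N ↔ s = 1 ∨ s = -1 ∨ Ucheb' (N + 1) s = 0 := by
  have h : derivative (U ℝ (N + 1)) ≠ 0 := by
    intro h
    have := natDegree_lobattoPoly N
    simp [lobattoPoly, h] at this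
  simp [lobattoNodes, h, Ucheb']

lemma card_lobattoNodes {N : ℕ} (hN : Even N) : (lobattoNodes N).card = N + 2 := by
  have h1 : ∀ s ∈ (derivative (U ℝ (N + 1))).roots.toFinset, |s| < 1 := fun s hs =>
    abs_lt_one_of_root hN (isRoot_of_mem_roots (Multiset.mem_toFinset.1 hs))
  rw [lobattoNodes, Finset.card_insert_of_notMem, Finset.card_insert_of_notMem,
    card_roots_derivative_U]
  · intro h
    simpa using h1 _ h
  · intro h
    rcases Finset.mem_insert.1 h with h | h
    · norm_num at h
    · simpa using h1 _ h

lemma exists_lobatto_bump {N : ℕ} (hN : Even N) (hN0 : N ≠ 0) {s : ℝ} (hs : s ∈ lobattoNodes N) :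
    ∃ M : ℝ[X], M.natDegree ≤ 2 * N + 1 ∧ 0 < M.eval s ∧
      (∀ s' ∈ lobattoNodes N, s' ≠ s → M.eval s' = 0) ∧
      ∀ x ∈ Set.Icc (-1 : ℝ) 1, 0 ≤ M.eval x := by
  set D := derivative (U ℝ (N + 1)) with hD
  have hDdeg : D.natDegree = N := natDegree_derivative_U N
  have hDpos : 0 < D.eval 1 := Ucheb'_pos le_rfl N
  have hDneg : D.eval (-1) = D.eval 1 := Ucheb'_neg hN 1
  rcases mem_lobattoNodes.1 hs with rfl | rfl | hroot
  · refine ⟨(1 + X) * D ^ 2, ?_, ?_, ?_, ?_⟩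
    · have : (1 + X : ℝ[X]).natDegree ≤ 1 := by compute_degree
      have := natDegree_mul_le_of_le this (natDegree_pow_le_of_le 2 hDdeg.le)
      omega
    · simp only [eval_mul, eval_add, eval_one, eval_X, eval_pow]
      positivity
    · intro s' hs' hne
      rcases mem_lobattoNodes.1 hs' with rfl | rfl | h
      · exact absurd rfl hne
      · simp
      · simp [show D.eval s' = 0 from h]
    · intro x hx
      simp only [eval_mul, eval_add, eval_one, eval_X, eval_pow]
      exact mul_nonneg (by linarith [hx.1]) (sq_nonneg _)
  · refine ⟨(1 - X) * D ^ 2, ?_, ?_, ?_, ?_⟩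
    · have : (1 - X : ℝ[X]).natDegree ≤ 1 := by compute_degree
      have := natDegree_mul_le_of_le this (natDegree_pow_le_of_le 2 hDdeg.le)
      omega
    · simp only [eval_mul, eval_sub, eval_one, eval_X, eval_pow, hDneg]
      norm_num
      positivity
    · intro s' hs' hne
      rcases mem_lobattoNodes.1 hs' with rfl | rfl | h
      · simp
      · exact absurd rfl hne
      · simp [show D.eval s' = 0 from h]
    · intro x hx
      simp only [eval_mul, eval_sub, eval_one, eval_X, eval_pow]
      exact mul_nonneg (by linarith [hx.2]) (sq_nonneg _)
  · have hs1 := abs_lt.1 (abs_lt_one_of_root hN hroot)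
    obtain ⟨E, hE⟩ := dvd_iff_isRoot.2 (show D.IsRoot s from hroot)
    have hE0 : E ≠ 0 := by
      rintro rfl
      simp [hE] at hDpos
    have hEdeg : E.natDegree = N - 1 := by
      have := congrArg natDegree hE
      rw [natDegree_mul (X_sub_C_ne_zero s) hE0, natDegree_X_sub_C, hDdeg] at this
      omega
    have hEs : E.eval s ≠ 0 := by
      intro h0
      have hmult : 1 < D.rootMultiplicity s := by
        refine (le_rootMultiplicity_iff (by intro h; simp [h] at hDpos)).2 ?_
        obtain ⟨F, hF⟩ := dvd_iff_isRoot.2 (show E.IsRoot s from h0)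
        exact ⟨F, by rw [hE, hF]; ring⟩
      have hnd : D.roots.Nodup := by
        rw [← Multiset.toFinset_card_eq_card_iff_nodup, card_roots_derivative_U]
        refine le_antisymm ?_ ((card_roots' _).trans hDdeg.le)
        exact (card_roots_derivative_U N).symm.le.trans (Multiset.toFinset_card_le _)
      have := Multiset.nodup_iff_count_le_one.1 hnd s
      rw [count_roots] at this
      omega
    refine ⟨(1 - X ^ 2) * E ^ 2, ?_, ?_, ?_, ?_⟩
    · have : (1 - X ^ 2 : ℝ[X]).natDegree ≤ 2 := by compute_degree
      have := natDegree_mul_le_of_le this (natDegree_pow_le_of_le 2 hEdeg.le)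
      omega
    · simp only [eval_mul, eval_sub, eval_one, eval_X, eval_pow]
      have : 0 < 1 - s ^ 2 := by nlinarith
      positivity
    · intro s' hs' hne
      rcases mem_lobattoNodes.1 hs' with rfl | rfl | h
      · simp
      · simp
      · have h' : D.eval s' = 0 := h
        rw [hE, eval_mul, mul_eq_zero] at h'
        rcases h' with h' | h'
        · simp [sub_eq_zero] at h'
          exact absurd h' hne
        · simp [h']
    · intro x hx
      simp only [eval_mul, eval_sub, eval_one, eval_X, eval_pow]
      exact mul_nonneg (by nlinarith [hx.1, hx.2]) (sq_nonneg _)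

/-- The polynomial `x ↦ U_{j-1}(1 - 2 * x ^ 2)`. -/
noncomputable def halfAngleU (j : ℕ) : ℝ[X] :=
  ∑ i ∈ Finset.range j, C ((-1 : ℝ) ^ i) * U ℝ (2 * i : ℕ)

lemma natDegree_halfAngleU_le {j N : ℕ} (h : j ≤ N) :
    (halfAngleU j).natDegree ≤ 2 * N - 2 := by
  refine natDegree_sum_le_of_forall_le _ _ fun i hi => (natDegree_C_mul_le _ _).trans ?_
  rw [natDegree_U_natCast]
  rw [Finset.mem_range] at hi
  omega

lemma halfAngleU_eval_neg (j : ℕ) (x : ℝ) : (halfAngleU j).eval (-x) = (halfAngleU j).eval x := by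
  simp only [halfAngleU, eval_finsetSum, eval_mul, U_eval_neg]
  refine Finset.sum_congr rfl fun i _ => ?_
  rw [Int.negOnePow_even _ ⟨i, by push_cast; ring⟩]
  simp

lemma sin_mul_halfAngleU (j : ℕ) (t : ℝ) :
    Real.sin t * (halfAngleU j).eval (Real.sin (t / 2)) = Real.sin (j * t) := by
  set φ := Real.pi / 2 - t / 2 with hφ
  have hcos : Real.sin (t / 2) = Real.cos φ := by rw [hφ, Real.cos_pi_div_two_sub]
  have hsin : Real.sin t = 2 * Real.sin φ * Real.cos φ := by
    rw [← Real.sin_two_mul, hφ, ← Real.sin_pi_sub]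
    ring_nf
  induction j with
  | zero => simp [halfAngleU]
  | succ j ih =>
    have hU := U_real_cos φ ((2 * j : ℕ) : ℤ)
    rw [halfAngleU, Finset.sum_range_succ, ← halfAngleU, eval_add, mul_add, ih, hcos, eval_mul,
      eval_C, hsin]
    have h1 : Real.sin ((2 * j + 1) * φ) = (-1) ^ j * Real.cos ((2 * j + 1) * (t / 2)) := by
      rw [show (2 * (j : ℝ) + 1) * φ = j * Real.pi + (Real.pi / 2 - (2 * j + 1) * (t / 2)) by
        rw [hφ]; ring, Real.sin_add, Real.sin_nat_mul_pi, Real.cos_nat_mul_pi,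
        Real.sin_pi_div_two_sub]
      ring
    have h2 : Real.sin ((j + 1 : ℕ) * t) - Real.sin (j * t) =
        2 * Real.sin (t / 2) * Real.cos ((2 * j + 1) * (t / 2)) := by
      rw [Real.sin_sub_sin]
      push_cast
      ring_nf
    have hsq : ((-1 : ℝ) ^ j) * (-1) ^ j = 1 := by rw [← mul_pow]; simp
    push_cast at hU h2 ⊢
    rw [h1] at hU
    rw [hcos] at h2
    linear_combination (-1) ^ j * 2 * Real.cos φ * hU - h2
      + 2 * Real.cos φ * Real.cos ((2 * j + 1) * (t / 2)) * hsq

lemma sqrtWeightIntegral_halfAngleU {j : ℕ} (hj : 1 ≤ j) :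
    sqrtWeightIntegral (halfAngleU j) = sqrtWeightIntegral 1 := by
  rw [halfAngleU, map_sum, Finset.sum_eq_single_of_mem 0 (Finset.mem_range.2 hj)]
  · simp
  · intro i _ hi
    rw [sqrtWeightIntegral_C_mul, sqrtWeightIntegral_U (by omega), mul_zero]

lemma X_sq_mul_U (m : ℤ) :
    X ^ 2 * U ℝ m = C (1 / 4) * (U ℝ (m + 2) + U ℝ (m - 2)) + C (1 / 2) * U ℝ m := by
  have h1 := X_mul_U m
  have h2 := X_mul_U (m + 1)
  have h3 := X_mul_U (m - 1)
  rw [add_sub_cancel_right, add_assoc, one_add_one_eq_two] at h2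
  rw [sub_add_cancel, sub_sub, one_add_one_eq_two] at h3
  have h4 : (C (1 / 4) : ℝ[X]) = C (1 / 2) * C (1 / 2) := by rw [← map_mul]; norm_num
  have h5 : (C (1 / 2) : ℝ[X]) = 2 * (C (1 / 2) * C (1 / 2)) := by
    rw [← map_ofNat C 2, ← map_mul, ← map_mul]; norm_num
  rw [h4]
  linear_combination X * h1 + C (1 / 2) * (h2 + h3) - U ℝ m * h5

lemma sqrtWeightIntegral_X_sq_mul_halfAngleU {j : ℕ} (hj : 1 ≤ j) :
    sqrtWeightIntegral (X ^ 2 * halfAngleU j) =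
      if j = 1 then sqrtWeightIntegral 1 / 4 else 0 := by
  have h0 : sqrtWeightIntegral (X ^ 2 * U ℝ 0) = sqrtWeightIntegral 1 / 4 := by
    have h2 : sqrtWeightIntegral (U ℝ 2) = 0 := sqrtWeightIntegral_U two_ne_zero
    rw [X_sq_mul_U, zero_add, zero_sub, U_neg_two, U_zero, map_add, sqrtWeightIntegral_C_mul,
      sqrtWeightIntegral_C_mul, map_add, map_neg, h2]
    ring
  have h1 : sqrtWeightIntegral (X ^ 2 * U ℝ 2) = sqrtWeightIntegral 1 / 4 := by
    have h2 : sqrtWeightIntegral (U ℝ 2) = 0 := sqrtWeightIntegral_U two_ne_zero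
    have h4 : sqrtWeightIntegral (U ℝ (2 + 2)) = 0 := sqrtWeightIntegral_U four_ne_zero
    rw [X_sq_mul_U, sub_self, map_add, sqrtWeightIntegral_C_mul,
      sqrtWeightIntegral_C_mul, map_add, h2, h4, U_zero]
    ring
  rw [halfAngleU, Finset.mul_sum, map_sum]
  simp only [mul_left_comm (X ^ 2), sqrtWeightIntegral_C_mul]
  rcases hj.eq_or_lt with rfl | hj
  · simpa using h0
  · obtain ⟨k, rfl⟩ : ∃ k, j = k + 2 := ⟨j - 2, by omega⟩
    rw [if_neg (by omega), Finset.sum_range_succ', Finset.sum_range_succ',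
      Finset.sum_eq_zero fun i _ => ?_]
    · rw [U_zero, mul_one] at h0
      simp [h0, h1]
    · rw [sqrtWeightIntegral_X_pow_mul_U _ _ (by omega), mul_zero]

/-- The sharp bound for the coefficient sum of a sine polynomial that is nonnegative on `[0, π]`. -/
lemma sum_le_of_sine_nonneg {N : ℕ} (hN : Even N) (hN0 : N ≠ 0) {ν : ℝ} (hν0 : 0 < ν)
    (hνroot : Ucheb' (N + 1) ν = 0)
    (hνleast : ∀ x : ℝ, 0 < x → x < ν → Ucheb' (N + 1) x ≠ 0) {b : ℕ → ℝ}
    (hb : ∀ t ∈ Set.Icc (0 : ℝ) Real.pi, 0 ≤ ∑ j ∈ Finset.Icc 1 N, b j * Real.sin (j * t)) :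
    ∑ j ∈ Finset.Icc 1 N, b j ≤ b 1 / (4 * ν ^ 2) := by
  have hν1 := abs_lt.1 (abs_lt_one_of_root hN hνroot)
  set Q : ℝ[X] := ∑ j ∈ Finset.Icc 1 N, C (b j) * halfAngleU j with hQ
  have hQneg : ∀ x, Q.eval (-x) = Q.eval x := by
    intro x
    simp only [hQ, eval_finsetSum, eval_mul, eval_C, halfAngleU_eval_neg]
  have hQpos : ∀ x ∈ Set.Ioo (0 : ℝ) 1, 0 ≤ Q.eval x := by
    intro x hx
    set t := 2 * Real.arcsin x with ht
    have hpos : 0 < t := by linarith [Real.arcsin_pos.2 hx.1]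
    have hlt : t < Real.pi := by linarith [Real.arcsin_lt_pi_div_two.2 hx.2]
    have hsum := hb t ⟨hpos.le, hlt.le⟩
    have hx' : Real.sin (t / 2) = x := by
      rw [ht, mul_div_cancel_left₀ _ two_ne_zero, Real.sin_arcsin (by linarith [hx.1]) hx.2.le]
    have heq : ∑ j ∈ Finset.Icc 1 N, b j * Real.sin (j * t) = Real.sin t * Q.eval x := by
      rw [hQ, eval_finsetSum, Finset.mul_sum]
      refine Finset.sum_congr rfl fun j _ => ?_
      rw [← sin_mul_halfAngleU, hx', eval_mul, eval_C]
      ring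
    rw [heq] at hsum
    exact nonneg_of_mul_nonneg_right hsum (Real.sin_pos_of_pos_of_lt_pi hpos hlt)
  have hQone : 0 ≤ Q.eval 1 := by
    have hcl : IsClosed {x : ℝ | 0 ≤ Q.eval x} := isClosed_le continuous_const Q.continuous
    have hsub : closure (Set.Ioo (0 : ℝ) 1) ⊆ {x : ℝ | 0 ≤ Q.eval x} :=
      hcl.closure_subset_iff.2 hQpos
    rw [closure_Ioo zero_ne_one] at hsub
    exact hsub ⟨zero_le_one, le_rfl⟩
  have hQdeg : Q.natDegree ≤ 2 * N - 2 :=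
    natDegree_sum_le_of_forall_le _ _ fun j hj => (natDegree_C_mul_le _ _).trans
      (natDegree_halfAngleU_le (Finset.mem_Icc.1 hj).2)
  have hval : sqrtWeightIntegral ((X ^ 2 - C (ν ^ 2)) * Q) =
      sqrtWeightIntegral 1 * (b 1 / 4 - ν ^ 2 * ∑ j ∈ Finset.Icc 1 N, b j) := by
    have h1 : sqrtWeightIntegral (X ^ 2 * Q) = b 1 * (sqrtWeightIntegral 1 / 4) := by
      rw [hQ, Finset.mul_sum, map_sum,
        Finset.sum_eq_single_of_mem 1 (Finset.mem_Icc.2 ⟨le_rfl, by omega⟩)]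
      · rw [mul_left_comm, sqrtWeightIntegral_C_mul,
          sqrtWeightIntegral_X_sq_mul_halfAngleU le_rfl, if_pos rfl]
      · intro j hj hne
        rw [mul_left_comm, sqrtWeightIntegral_C_mul,
          sqrtWeightIntegral_X_sq_mul_halfAngleU (Finset.mem_Icc.1 hj).1, if_neg hne, mul_zero]
    have h2 : sqrtWeightIntegral Q = (∑ j ∈ Finset.Icc 1 N, b j) * sqrtWeightIntegral 1 := by
      rw [hQ, map_sum, Finset.sum_mul]
      refine Finset.sum_congr rfl fun j hj => ?_
      rw [sqrtWeightIntegral_C_mul, sqrtWeightIntegral_halfAngleU (Finset.mem_Icc.1 hj).1]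
    rw [sub_mul, map_sub, sqrtWeightIntegral_C_mul, h1, h2]
    ring
  have hnonneg : 0 ≤ sqrtWeightIntegral ((X ^ 2 - C (ν ^ 2)) * Q) := by
    refine sqrtWeightIntegral_nonneg_of_nodes hN0 (card_lobattoNodes hN) (fun s hs => ?_) ?_
      (fun s hs => ?_) fun s hs => exists_lobatto_bump hN hN0 hs
    · rcases mem_lobattoNodes.1 hs with rfl | rfl | h
      · simp [lobattoPoly]
      · simp [lobattoPoly]
      · rw [lobattoPoly, eval_mul, show eval s (derivative (U ℝ (N + 1))) = 0 from h, mul_zero]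
    · have : (X ^ 2 - C (ν ^ 2)).natDegree ≤ 2 := by compute_degree
      have := natDegree_mul_le_of_le this hQdeg
      omega
    · rw [eval_mul, eval_sub, eval_pow, eval_X, eval_C]
      rcases mem_lobattoNodes.1 hs with rfl | rfl | h
      · exact mul_nonneg (by nlinarith) hQone
      · rw [hQneg]
        exact mul_nonneg (by nlinarith) hQone
      · have hsq : (|s|) ^ 2 = s ^ 2 := sq_abs s
        have hQs : Q.eval s = Q.eval |s| := by
          rcases abs_choice s with h' | h' <;> rw [h']
          rw [hQneg]
        have hroot : Ucheb' (N + 1) |s| = 0 := by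
          rcases abs_choice s with h' | h' <;> rw [h']
          · exact h
          · rwa [Ucheb'_neg hN]
        have hs0 : 0 < |s| := abs_pos.2 fun h0 => Ucheb'_zero_ne_zero hN (h0 ▸ h)
        have hνs : ν ≤ |s| := not_lt.1 fun hlt => hνleast _ hs0 hlt hroot
        rw [← hsq, hQs]
        exact mul_nonneg (by nlinarith) (hQpos _ ⟨hs0, abs_lt_one_of_root hN h⟩)
  rw [hval] at hnonneg
  have := nonneg_of_mul_nonneg_right hnonneg sqrtWeightIntegral_one_pos
  rw [le_div_iff₀ (by positivity)]
  linarith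

end Quadrature

/-- The zero-extended signed coordinates form a kernel vector of a pentadiagonal matrix. -/
lemma zCoord_lagSum {N : ℕ} {ν : ℝ} (hνroot : Ucheb' (N + 1) ν = 0) {z : ℕ → ℝ}
    (hz : ∀ k : ℕ, 1 ≤ k → k ≤ N → z k = zCoord N k ν) :
    4 * ν ^ 2 * (lagSum z N 0 + lagSum z N 1) = lagSum z N 0 - lagSum z N 2 := by
  set w : ℕ → ℝ := fun i => (-1) ^ i * unsignedZ N ν (i - 1) with hw
  have hlag : ∀ k, lagSum z N k = lagSum (fun k => w (k + 1)) N k := by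
    have hzw : ∀ k : ℕ, 1 ≤ k → k ≤ N → z k = w (k + 1) := by
      intro k hk1 hkN
      obtain ⟨m, rfl⟩ : ∃ m, k = m + 1 := ⟨k - 1, by omega⟩
      rw [hz _ hk1 hkN]
      simp only [hw, zCoord, unsignedZ]
      push_cast
      simp only [add_sub_cancel_right]
      ring
    intro k
    refine Finset.sum_congr rfl fun j hj => ?_
    rw [Finset.mem_Icc] at hj
    rw [hzw j (by omega) (by omega), hzw (j + k) (by omega) (by omega)]
  have h := toeplitz_form_eq_zero (w := w) (N := N) (a := 1 - 4 * ν ^ 2) (b := -(2 * ν ^ 2))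
    (c := -(1 / 2)) ?_ ?_ ?_ ?_ ?_
  · rw [hlag, hlag, hlag]
    linear_combination -h
  · simpa [hw] using unsignedZ_neg_one hνroot
  · simpa [hw] using unsignedZ_zero N ν
  · have := unsignedZ_reflect N ν 0
    rw [unsignedZ_zero, neg_zero, sub_zero] at this
    simp only [hw]
    push_cast
    rw [show (N : ℤ) + 2 - 1 = N + 1 by ring, this, mul_zero]
  · have := unsignedZ_reflect N ν (-1)
    rw [unsignedZ_neg_one hνroot, neg_zero] at this
    simp only [hw]
    push_cast
    rw [show (N : ℤ) + 3 - 1 = N + 1 - (-1) by ring, this, mul_zero]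
  · intro i _
    have := unsignedZ_rec N ν (i + 1)
    simp only [hw]
    push_cast
    ring_nf at this ⊢
    linear_combination (-1) ^ i * this

theorem stmt16 (N : ℕ) (hN : 4 ≤ N) (hNeven : Even N)
    (ν : ℝ) (hν0 : 0 < ν) (hνroot : Ucheb' (N + 1) ν = 0)
    (hνleast : ∀ x : ℝ, 0 < x → x < ν → Ucheb' (N + 1) x ≠ 0)
    (z : ℕ → ℝ) (hz : ∀ k : ℕ, 1 ≤ k → k ≤ N → z k = zCoord N k ν)
    (β2 : ℝ)
    (hβ2 : β2 = ∑ j ∈ Finset.Icc 1 N, z j ^ 2 - ∑ j ∈ Finset.Icc 1 (N - 2), z j * z (j + 2))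
    (α : ℕ → ℝ)
    (hα : ∀ k : ℕ, 1 ≤ k → k ≤ N - 2 →
      α k = (∑ j ∈ Finset.Icc 1 (N - k + 1), z j * z (j + k - 1)
              - ∑ j ∈ Finset.Icc 1 (N - k - 1), z j * z (j + k + 1)) / β2)
    (hαN1 : α (N - 1) = (z 1 * z (N - 1) + z 2 * z N) / β2)
    (hαN : α N = z 1 * z N / β2) :
    α 1 = 1
      ∧ (∀ t ∈ Set.Icc (0 : ℝ) Real.pi, 0 ≤ ∑ j ∈ Finset.Icc 1 N, α j * Real.sin (j * t))
      ∧ ∑ j ∈ Finset.Icc 1 N, α j = 1 / (4 * ν ^ 2)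
      ∧ ∀ b : ℕ → ℝ, b 1 = 1 →
          (∀ t ∈ Set.Icc (0 : ℝ) Real.pi, 0 ≤ ∑ j ∈ Finset.Icc 1 N, b j * Real.sin (j * t)) →
          ∑ j ∈ Finset.Icc 1 N, b j ≤ ∑ j ∈ Finset.Icc 1 N, α j := by
  have hν1 := abs_lt.1 (abs_lt_one_of_root hNeven hνroot)
  have hz1 : z 1 ≠ 0 := by
    have h := unsignedZ_one_pos hν0 hν1.2 hνroot
    rw [hz 1 le_rfl (by omega)]
    simpa [zCoord, unsignedZ] using h.ne'
  have hβ : β2 = lagSum z N 0 - lagSum z N 2 := by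
    rw [hβ2]
    simp [lagSum, pow_two]
  have hβpos : 0 < β2 := hβ ▸ lagSum_zero_sub_lagSum_two_pos (by omega) hz1
  have hα' : ∀ k ∈ Finset.Icc 1 N, α k = (lagSum z N (k - 1) - lagSum z N (k + 1)) / β2 := by
    intro k hk
    rw [Finset.mem_Icc] at hk
    rcases (by omega : k ≤ N - 2 ∨ k = N - 1 ∨ k = N) with h | h | h
    · rw [hα k hk.1 h, lagSum, lagSum, show N - (k - 1) = N - k + 1 by omega, Nat.sub_sub]
      simp only [Nat.add_sub_assoc hk.1, add_assoc]
    · rw [lagSum_of_le (by omega : N ≤ k + 1), h, hαN1, lagSum,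
        show N - (N - 1 - 1) = 1 + 1 by omega, Finset.sum_Icc_succ_top (by omega),
        Finset.Icc_self, Finset.sum_singleton, show 1 + (N - 1 - 1) = N - 1 by omega,
        show 1 + 1 + (N - 1 - 1) = N by omega, sub_zero]
    · rw [lagSum_of_le (by omega : N ≤ k + 1), h, hαN, lagSum,
        show N - (N - 1) = 1 by omega, Finset.Icc_self, Finset.sum_singleton,
        show 1 + (N - 1) = N by omega, sub_zero]
  have hsum : ∑ j ∈ Finset.Icc 1 N, α j = 1 / (4 * ν ^ 2) := by
    rw [Finset.sum_congr rfl hα', ← Finset.sum_div, sum_sub_lag_two, lagSum_of_le le_rfl,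
      lagSum_of_le N.le_succ, sub_zero, sub_zero, div_eq_div_iff hβpos.ne' (by positivity), hβ]
    linear_combination zCoord_lagSum hνroot hz
  refine ⟨?_, fun t ht => ?_, hsum, fun b hb1 hb => ?_⟩
  · rw [hα' 1 (Finset.mem_Icc.2 ⟨le_rfl, by omega⟩), hβ, div_self (hβ ▸ hβpos.ne')]
  · have h : ∑ j ∈ Finset.Icc 1 N, α j * Real.sin (j * t) =
        (∑ k ∈ Finset.Icc 1 N,
          (lagSum z N (k - 1) - lagSum z N (k + 1)) * Real.sin (k * t)) / β2 := by
      rw [Finset.sum_div]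
      refine Finset.sum_congr rfl fun k hk => ?_
      rw [hα' k hk, div_mul_eq_mul_div]
    rw [h, sum_lagSum_mul_sin]
    exact div_nonneg (mul_nonneg (Real.sin_nonneg_of_mem_Icc ht) (by positivity)) hβpos.le
  · rw [hsum, ← hb1]
    exact sum_le_of_sine_nonneg hNeven (by omega) hν0 hνroot hνleast hb
end

section
/- Let N be an odd positive integer, set μ = sin(π/(2(N+2))), and define α_k = (−1)^{k−1} · U'_{N−k+1}(μ) · U_{k−1}(μ) / U'_N(μ) for k = 1,…,N, where U' denotes the derivative of the Chebyshev polynomial of the second kind. Then α_1 = 1, the sine polynomial ∑_{j=1}^N α_j sin(jt) is nonnegative for all t ∈ [0, π], and ∑_{k=1}^N α_k = (1/4)·csc²(π/(2(N+2))); i.e., (α_1,…,α_N) is the extremal vector attaining the maximum of ∑_{j=1}^N α_j over S_N. -/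
open Finset

theorem two_mul_cos_sub_cos_mul_sum_sin_mul_sin (x y : ℝ) (n : ℕ) :
    2 * (Real.cos x - Real.cos y) * ∑ k ∈ range n, Real.sin (k * y) * Real.sin (k * x) =
      Real.sin (n * y - y) * Real.sin (n * x) - Real.sin (n * y) * Real.sin (n * x - x) := by
  induction n with
  | zero => simp
  | succ n ih =>
    rw [sum_range_succ, mul_add, ih]
    push_cast
    rw [show ((n : ℝ) + 1) * y - y = n * y by ring, show ((n : ℝ) + 1) * x - x = n * x by ring,
      add_one_mul, add_one_mul, Real.sin_sub, Real.sin_sub, Real.sin_add, Real.sin_add]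
    ring

theorem two_mul_cos_sub_cos_mul_sum_cos_mul_sin (x y : ℝ) (n : ℕ) :
    2 * (Real.cos x - Real.cos y) * ∑ k ∈ range n, Real.cos (k * y) * Real.sin (k * x) =
      Real.cos (n * y - y) * Real.sin (n * x) - Real.cos (n * y) * Real.sin (n * x - x)
        - Real.sin x := by
  induction n with
  | zero => simp
  | succ n ih =>
    rw [sum_range_succ, mul_add, ih]
    push_cast
    rw [show ((n : ℝ) + 1) * y - y = n * y by ring, show ((n : ℝ) + 1) * x - x = n * x by ring,
      add_one_mul, add_one_mul, Real.sin_sub, Real.cos_sub, Real.sin_add, Real.cos_add]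
    ring

theorem two_mul_cos_add_one_mul_sum_neg_one_pow_mul_sin (x : ℝ) (n : ℕ) :
    2 * (Real.cos x + 1) * ∑ k ∈ range n, (-1 : ℝ) ^ k * Real.sin (k * x) =
      -((-1) ^ n * (Real.sin (n * x) + Real.sin (n * x - x))) - Real.sin x := by
  induction n with
  | zero => simp
  | succ n ih =>
    rw [sum_range_succ, mul_add, ih]
    push_cast
    rw [show ((n : ℝ) + 1) * x - x = n * x by ring,
      add_one_mul, Real.sin_sub, Real.sin_add]
    ring

theorem four_mul_sq_mul_sum_sub_mul_sin_mul_sin (x y : ℝ) (n : ℕ) :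
    4 * (Real.cos x - Real.cos y) ^ 2 *
        ∑ k ∈ range n, ((n : ℝ) - k) * (Real.sin (k * y) * Real.sin (k * x)) =
      (Real.cos x - Real.cos y) *
          (Real.sin (n * y - y) * Real.sin (n * x) - Real.sin (n * y) * Real.sin (n * x - x))
        + Real.sin x * (Real.sin (n * y - y) * Real.cos (n * x)
          - Real.sin (n * y) * Real.cos (n * x - x) + Real.sin y)
        - Real.sin y * (Real.cos (n * y - y) * Real.sin (n * x)
          - Real.cos (n * y) * Real.sin (n * x - x) - Real.sin x) := by
  induction n with
  | zero => simp
  | succ n ih =>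
    have hsplit : ∑ k ∈ range (n + 1),
        (((n + 1 : ℕ) : ℝ) - k) * (Real.sin (k * y) * Real.sin (k * x)) =
        ∑ k ∈ range n, ((n : ℝ) - k) * (Real.sin (k * y) * Real.sin (k * x))
          + ∑ k ∈ range (n + 1), Real.sin (k * y) * Real.sin (k * x) := by
      rw [sum_range_succ, sum_range_succ, ← add_assoc, ← sum_add_distrib]
      push_cast
      congr 1
      · exact sum_congr rfl fun k _ => by ring
      · ring
    have h := two_mul_cos_sub_cos_mul_sum_sin_mul_sin x y (n + 1)
    rw [hsplit, mul_add, ih, show 4 * (Real.cos x - Real.cos y) ^ 2 *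
      ∑ k ∈ range (n + 1), Real.sin (k * y) * Real.sin (k * x) =
      2 * (Real.cos x - Real.cos y) * (2 * (Real.cos x - Real.cos y) *
      ∑ k ∈ range (n + 1), Real.sin (k * y) * Real.sin (k * x)) by ring, h]
    push_cast
    rw [show ((n : ℝ) + 1) * y - y = n * y by ring, show ((n : ℝ) + 1) * x - x = n * x by ring,
      add_one_mul, add_one_mul, Real.sin_sub, Real.cos_sub, Real.sin_add, Real.cos_add,
      Real.sin_sub, Real.cos_sub, Real.sin_add, Real.cos_add]
    ring

/-- The coefficients, up to a common factor, of the sine polynomial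
`sin x * (1 + cos (M x)) / ((1 + cos x) * (cos x - cos (π / M)) ^ 2)`. -/
noncomputable def extremalCoeff (M k : ℕ) : ℝ :=
  (M - k) * Real.sin (k * (Real.pi / M)) * Real.cos (Real.pi / M / 2)
    + (Real.cos (k * (Real.pi / M)) - (-1) ^ k) * Real.sin (Real.pi / M / 2)

theorem two_mul_mul_sum_extremalCoeff_mul_sin {M : ℕ} (hM : Odd M) (x : ℝ) :
    2 * (Real.cos x - Real.cos (Real.pi / M)) ^ 2 * (1 + Real.cos x) *
        ∑ k ∈ range M, extremalCoeff M k * Real.sin (k * x) =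
      Real.sin (Real.pi / M / 2) * (1 + Real.cos (Real.pi / M)) ^ 2 *
        (Real.sin x * (1 + Real.cos (M * x))) := by
  have hM0 : (M : ℝ) ≠ 0 := by exact_mod_cast hM.pos.ne'
  have h₁ := four_mul_sq_mul_sum_sub_mul_sin_mul_sin x (Real.pi / M) M
  have h₂ := two_mul_cos_sub_cos_mul_sum_cos_mul_sin x (Real.pi / M) M
  have h₃ := two_mul_cos_add_one_mul_sum_neg_one_pow_mul_sin x M
  have hsum : ∑ k ∈ range M, extremalCoeff M k * Real.sin (k * x) =
      Real.cos (Real.pi / M / 2) * ∑ k ∈ range M, ((M : ℝ) - k) *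
          (Real.sin (k * (Real.pi / M)) * Real.sin (k * x))
        + Real.sin (Real.pi / M / 2) * (∑ k ∈ range M, Real.cos (k * (Real.pi / M)) *
          Real.sin (k * x) - ∑ k ∈ range M, (-1 : ℝ) ^ k * Real.sin (k * x)) := by
    rw [← sum_sub_distrib, mul_sum, mul_sum, ← sum_add_distrib]
    exact sum_congr rfl fun k _ => by rw [extremalCoeff]; ring
  have hpi : (M : ℝ) * (Real.pi / M) = Real.pi := mul_div_cancel₀ _ hM0
  have hcos : Real.cos (Real.pi / M) = 2 * Real.cos (Real.pi / M / 2) ^ 2 - 1 := by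
    rw [← Real.cos_two_mul]; congr 1; ring
  have hsin : Real.sin (Real.pi / M) =
      2 * Real.sin (Real.pi / M / 2) * Real.cos (Real.pi / M / 2) := by
    rw [← Real.sin_two_mul]; congr 1; ring
  rw [hsum]
  rw [hpi, Real.sin_pi_sub, Real.cos_pi_sub, Real.sin_pi, Real.cos_pi, Real.sin_sub] at h₁
  rw [hpi, Real.cos_pi_sub, Real.cos_pi, Real.sin_sub] at h₂
  rw [hM.neg_one_pow, Real.sin_sub] at h₃
  rw [hsin] at h₁
  generalize ∑ k ∈ range M, ((M : ℝ) - k) *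
    (Real.sin (k * (Real.pi / M)) * Real.sin (k * x)) = S₁ at *
  generalize ∑ k ∈ range M, Real.cos (k * (Real.pi / M)) * Real.sin (k * x) = S₂ at *
  generalize ∑ k ∈ range M, (-1 : ℝ) ^ k * Real.sin (k * x) = S₃ at *
  generalize Real.cos (Real.pi / M) = C at *
  generalize Real.sin (Real.pi / M / 2) = s at *
  generalize Real.cos (Real.pi / M / 2) = c at *
  subst hcos
  linear_combination (1 + Real.cos x) * c / 2 * h₁
    + s * (Real.cos x - (2 * c ^ 2 - 1)) * (1 + Real.cos x) * h₂
    - s * (Real.cos x - (2 * c ^ 2 - 1)) ^ 2 * h₃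

theorem sum_cos_int_mul_odd {M : ℕ} {l : ℤ} (hl : Real.sin (l * (Real.pi / M)) ≠ 0) :
    ∑ m ∈ range M, Real.cos (l * ((2 * m + 1) * (Real.pi / M))) = 0 := by
  have key (n : ℕ) : 2 * Real.sin (l * (Real.pi / M)) *
      ∑ m ∈ range n, Real.cos (l * ((2 * m + 1) * (Real.pi / M))) =
        Real.sin (2 * n * (l * (Real.pi / M))) := by
    induction n with
    | zero => simp
    | succ n ih =>
      rw [sum_range_succ, mul_add, ih, Real.two_mul_sin_mul_cos,
        show l * (Real.pi / M) - l * ((2 * n + 1) * (Real.pi / M)) =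
          -(2 * n * (l * (Real.pi / M))) by ring, Real.sin_neg]
      push_cast
      rw [show l * (Real.pi / M) + l * ((2 * n + 1) * (Real.pi / M)) =
        2 * (n + 1) * (l * (Real.pi / M)) by ring]
      ring
  rcases eq_or_ne M 0 with rfl | hM
  · simp
  have h := key M
  rw [show 2 * (M : ℝ) * (l * (Real.pi / M)) = (2 * l : ℤ) * Real.pi by
    push_cast; field_simp, Real.sin_int_mul_pi] at h
  simpa [hl] using h

theorem sum_sin_mul_sin_odd {M j k : ℕ} (hj : 0 < j) (hjM : j < M) (hk : 0 < k) (hkM : k < M) :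
    ∑ m ∈ range M, Real.sin (j * ((2 * m + 1) * (Real.pi / M))) *
        Real.sin (k * ((2 * m + 1) * (Real.pi / M))) =
      M / 2 * ((if k = j then 1 else 0) + (if k = M - j then 1 else 0)) := by
  have hM0 : (M : ℝ) ≠ 0 := by exact_mod_cast (hj.trans hjM).ne'
  have hprod : ∑ m ∈ range M, Real.sin (j * ((2 * m + 1) * (Real.pi / M))) *
        Real.sin (k * ((2 * m + 1) * (Real.pi / M))) =
      1 / 2 * (∑ m ∈ range M, Real.cos (((j - k : ℤ) : ℝ) * ((2 * m + 1) * (Real.pi / M)))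
        - ∑ m ∈ range M, Real.cos (((j + k : ℤ) : ℝ) * ((2 * m + 1) * (Real.pi / M)))) := by
    rw [← sum_sub_distrib, mul_sum]
    refine sum_congr rfl fun m _ => ?_
    push_cast
    rw [sub_mul (j : ℝ), add_mul (j : ℝ), ← Real.two_mul_sin_mul_sin]
    ring
  have hsin {l : ℤ} (h : ¬ (M : ℤ) ∣ l) : Real.sin (l * (Real.pi / M)) ≠ 0 := by
    rw [Real.sin_ne_zero_iff]
    intro n hn
    apply h
    refine ⟨n, ?_⟩
    have : (l : ℝ) = M * n := by
      field_simp at hn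
      linarith
    exact_mod_cast this
  have hdiff : ∑ m ∈ range M, Real.cos (((j - k : ℤ) : ℝ) * ((2 * m + 1) * (Real.pi / M))) =
      M * (if k = j then 1 else 0) := by
    split_ifs with h
    · simp [h]
    · rw [sum_cos_int_mul_odd, mul_zero]
      refine hsin fun hd => ?_
      have := Int.eq_zero_of_abs_lt_dvd hd (by rw [abs_lt]; omega)
      omega
  have hadd : ∑ m ∈ range M, Real.cos (((j + k : ℤ) : ℝ) * ((2 * m + 1) * (Real.pi / M))) =
      -(M * (if k = M - j then 1 else 0)) := by
    split_ifs with h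
    · have : ((j + k : ℤ) : ℝ) = M := by
        exact_mod_cast (show (j + k : ℤ) = M by omega)
      rw [sum_congr rfl (g := fun _ => (-1 : ℝ)) fun m _ => ?_]
      · simp
      · rw [this, show (M : ℝ) * ((2 * m + 1) * (Real.pi / M)) = Real.pi + m * (2 * Real.pi) by
          field_simp; ring, Real.cos_add_nat_mul_two_pi, Real.cos_pi]
    · rw [sum_cos_int_mul_odd, mul_zero, neg_zero]
      refine hsin fun hd => ?_
      have := Int.eq_zero_of_abs_lt_dvd (x := j + k - M) (m := M) (by simpa using hd)
        (by rw [abs_lt]; omega)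
      omega
  rw [hprod, hdiff, hadd]
  ring

/-- The weight, at the nodes `(2 m + 1) π / M`, of a quadrature formula for the functional
`b ↦ l * b 1 - ∑ j, b j` on sine polynomials. -/
noncomputable def quadWeight (M : ℕ) (l t : ℝ) : ℝ :=
  2 * l * Real.sin t - ∑ k ∈ Icc 1 (M - 1), Real.sin (k * t)

theorem sum_quadWeight_mul {N : ℕ} (hN : 0 < N) (l : ℝ) (b : ℕ → ℝ) :
    ∑ m ∈ range (N + 2), quadWeight (N + 2) l ((2 * m + 1) * (Real.pi / (N + 2 : ℕ))) *
        ∑ j ∈ Icc 1 N, b j * Real.sin (j * ((2 * m + 1) * (Real.pi / (N + 2 : ℕ)))) =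
      (N + 2 : ℕ) * (l * b 1 - ∑ j ∈ Icc 1 N, b j) := by
  have hcol (j : ℕ) (hj : j ∈ Icc 1 N) :
      ∑ m ∈ range (N + 2), quadWeight (N + 2) l ((2 * m + 1) * (Real.pi / (N + 2 : ℕ))) *
        Real.sin (j * ((2 * m + 1) * (Real.pi / (N + 2 : ℕ)))) =
      (N + 2 : ℕ) * ((if j = 1 then l else 0) - 1) := by
    obtain ⟨hj1, hjN⟩ := mem_Icc.1 hj
    have h₁ := sum_sin_mul_sin_odd (M := N + 2) (j := 1) (k := j) (by omega) (by omega)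
      (by omega) (by omega)
    have h₂ : ∑ m ∈ range (N + 2), (∑ k ∈ Icc 1 (N + 2 - 1),
        Real.sin (k * ((2 * m + 1) * (Real.pi / (N + 2 : ℕ))))) *
        Real.sin (j * ((2 * m + 1) * (Real.pi / (N + 2 : ℕ)))) = (N + 2 : ℕ) := by
      simp_rw [sum_mul]
      rw [sum_comm, sum_congr rfl fun k hk => (sum_congr rfl fun m _ => mul_comm _ _).trans
        (sum_sin_mul_sin_odd (M := N + 2) (j := j) (k := k) (by omega) (by omega)
          (by rw [mem_Icc] at hk; omega) (by rw [mem_Icc] at hk; omega))]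
      rw [← mul_sum, sum_add_distrib, sum_ite_eq', sum_ite_eq', if_pos, if_pos]
      · ring
      all_goals rw [mem_Icc]; omega
    simp_rw [quadWeight, sub_mul, sum_sub_distrib, h₂, mul_assoc, ← mul_sum]
    rw [if_neg (show j ≠ N + 2 - 1 by omega)] at h₁
    simp only [Nat.cast_one, one_mul] at h₁
    rw [h₁]
    split_ifs <;> ring
  simp_rw [mul_sum]
  rw [sum_comm, mul_sub, mul_sum]
  rw [sum_congr rfl (g := fun j => (N + 2 : ℕ) * (if j = 1 then l * b 1 else 0)
    - (N + 2 : ℕ) * b j) fun j hj => ?_]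
  · rw [sum_sub_distrib, ← mul_sum, sum_ite_eq', if_pos (mem_Icc.2 ⟨le_rfl, hN⟩)]
  · simp_rw [mul_left_comm _ (b j)]
    rw [← mul_sum, hcol j hj]
    split_ifs with h
    · rw [h]; ring
    · ring

theorem quadWeight_mul {M : ℕ} {t y : ℝ} (hM : 0 < M) (ht : Real.cos (M * t) = -1)
    (hy : Real.cos y ≠ 1) :
    quadWeight M (1 / (2 * (1 - Real.cos y))) t * ((1 - Real.cos t) * (1 - Real.cos y)) =
      Real.sin t * (Real.cos y - Real.cos t) := by
  have key (n : ℕ) : 2 * (1 - Real.cos t) * ∑ k ∈ Icc 1 n, Real.sin (k * t) =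
      Real.sin t + Real.sin (n * t) - Real.sin ((n + 1) * t) := by
    induction n with
    | zero => simp
    | succ n ih =>
      rw [sum_Icc_succ_top (by omega), mul_add, ih]
      push_cast
      rw [add_one_mul (n + 1 : ℝ), show (n : ℝ) * t = (n + 1) * t - t by ring, Real.sin_add,
        Real.sin_sub]
      ring
  have hs : Real.sin (M * t) = 0 := by
    have := Real.sin_sq_add_cos_sq (M * t)
    rw [ht] at this
    simpa using this
  have h := key (M - 1)
  rw [Nat.cast_sub (by omega), Nat.cast_one, sub_add_cancel, sub_one_mul, Real.sin_sub, hs, ht] at h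
  rw [quadWeight]
  have hy' : 1 - Real.cos y ≠ 0 := sub_ne_zero.2 hy.symm
  have hl : 2 * (1 / (2 * (1 - Real.cos y))) * (1 - Real.cos y) = 1 := by field_simp
  linear_combination Real.sin t * (1 - Real.cos t) * hl - (1 - Real.cos y) / 2 * h

theorem Ucheb'_cos_mul_sin_pow_three (n : ℤ) (θ : ℝ) :
    Ucheb' n (Real.cos θ) * Real.sin θ ^ 3 =
      Real.cos θ * Real.sin ((n + 1) * θ) - (n + 1) * Real.cos ((n + 1) * θ) * Real.sin θ := by
  have h := congrArg (Polynomial.eval (Real.cos θ))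
    (Polynomial.Chebyshev.add_one_mul_T_eq_poly_in_U (R := ℝ) n)
  have hU := Polynomial.Chebyshev.U_real_cos θ n
  simp only [Polynomial.eval_mul, Polynomial.eval_add, Polynomial.eval_sub, Polynomial.eval_pow,
    Polynomial.eval_X, Polynomial.eval_one, Polynomial.eval_intCast,
    Polynomial.Chebyshev.T_real_cos] at h
  push_cast at h
  rw [Ucheb']
  rw [← Real.sin_sq] at h
  rw [← hU]
  linear_combination Real.sin θ * h

theorem extremalCoeff_eq_Ucheb (r k : ℕ) (hk : 1 ≤ k) :
    extremalCoeff (2 * r + 1) k =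
      -2 * (-1) ^ r * Real.cos (Real.pi / (2 * r + 1 : ℕ) / 2) ^ 4 *
        ((-1) ^ (k - 1) * Ucheb' (2 * r + 1 - k - 1) (Real.sin (Real.pi / (2 * r + 1 : ℕ) / 2)) *
          Ucheb (k - 1) (Real.sin (Real.pi / (2 * r + 1 : ℕ) / 2))) := by
  set y : ℝ := Real.pi / (2 * r + 1 : ℕ) with hy
  set θ : ℝ := Real.pi / 2 - y / 2 with hθ
  have hc : Real.cos (y / 2) = Real.sin θ := by rw [hθ, Real.sin_pi_div_two_sub]
  have hs : Real.sin (y / 2) = Real.cos θ := by rw [hθ, Real.cos_pi_div_two_sub]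
  have hU' := Ucheb'_cos_mul_sin_pow_three (2 * r + 1 - k - 1) θ
  have hU := Polynomial.Chebyshev.U_real_cos θ (k - 1)
  have hangle : ((2 * r + 1 - k : ℝ)) * θ = r * Real.pi - k * θ := by
    rw [hθ, hy]; push_cast; field_simp; ring
  push_cast at hU hU'
  rw [sub_add_cancel, hangle, Real.sin_nat_mul_pi_sub, Real.cos_nat_mul_pi_sub] at hU'
  rw [sub_add_cancel] at hU
  have hky : k * y = k * Real.pi - 2 * (k * θ) := by rw [hθ]; ring
  have hpow : (-1 : ℝ) ^ (k - 1) = -(-1) ^ k := by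
    obtain ⟨k, rfl⟩ := Nat.exists_eq_add_of_le' hk
    rw [Nat.add_sub_cancel, pow_succ]; ring
  have hr : ((-1 : ℝ) ^ r) ^ 2 = 1 := by rw [← pow_mul, mul_comm, pow_mul]; simp
  rw [extremalCoeff, ← hy, hc, hs, hky, Real.sin_nat_mul_pi_sub, Real.cos_nat_mul_pi_sub,
    Real.sin_two_mul, Real.cos_two_mul, hpow, Ucheb,
    show -2 * (-1) ^ r * Real.sin θ ^ 4 * (-(-1) ^ k * Ucheb' (2 * r + 1 - k - 1) (Real.cos θ) *
      (Polynomial.Chebyshev.U ℝ (k - 1)).eval (Real.cos θ)) = 2 * (-1) ^ r * (-1) ^ k *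
      (Ucheb' (2 * r + 1 - k - 1) (Real.cos θ) * Real.sin θ ^ 3) *
      ((Polynomial.Chebyshev.U ℝ (k - 1)).eval (Real.cos θ) * Real.sin θ) by ring, hU, hU']
  push_cast
  linear_combination 2 * (-1) ^ k * (Real.sin (k * θ) ^ 2 * Real.cos θ +
      (2 * r + 1 - k) * Real.sin (k * θ) * Real.cos (k * θ) * Real.sin θ) * hr +
    2 * (-1) ^ k * Real.cos θ * Real.sin_sq_add_cos_sq (k * θ)

theorem extremalCoeff_one_pos {M : ℕ} (hM : 1 < M) : 0 < extremalCoeff M 1 := by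
  have hM' : (1 : ℝ) < M := by exact_mod_cast hM
  have hpos : 0 < Real.pi / M := div_pos Real.pi_pos (by linarith)
  have hlt : Real.pi / M < Real.pi := div_lt_self Real.pi_pos hM'
  have h₁ : 0 < Real.sin (Real.pi / M) := Real.sin_pos_of_pos_of_lt_pi hpos hlt
  have h₂ : 0 < Real.sin (Real.pi / M / 2) :=
    Real.sin_pos_of_pos_of_lt_pi (by linarith) (by linarith)
  have h₃ : 0 < Real.cos (Real.pi / M / 2) :=
    Real.cos_pos_of_mem_Ioo ⟨by linarith, by linarith⟩
  have h₄ : -1 < Real.cos (Real.pi / M) := by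
    rw [← Real.cos_pi]
    exact Real.cos_lt_cos_of_nonneg_of_le_pi hpos.le le_rfl hlt
  have h₅ : 0 < (M : ℝ) - 1 := by linarith
  have h₆ : 0 < Real.cos (Real.pi / M) + 1 := by linarith
  rw [extremalCoeff]
  simp only [Nat.cast_one, one_mul, pow_one, sub_neg_eq_add]
  positivity

theorem sum_extremalCoeff_mul_sin_nonneg {M : ℕ} (hM : Odd M) (hM1 : 1 < M) {t : ℝ}
    (ht : t ∈ Set.Icc 0 Real.pi) : 0 ≤ ∑ k ∈ range M, extremalCoeff M k * Real.sin (k * t) := by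
  have hM' : (1 : ℝ) < M := by exact_mod_cast hM1
  have hy0 : 0 < Real.pi / M := div_pos Real.pi_pos (by linarith)
  have hyπ : Real.pi / M < Real.pi := div_lt_self Real.pi_pos hM'
  have hs : 0 ≤ Real.sin (Real.pi / M / 2) :=
    Real.sin_nonneg_of_nonneg_of_le_pi (by linarith) (by linarith)
  have off_node (x : ℝ) (hx0 : 0 < x) (hxπ : x < Real.pi) (hx : x ≠ Real.pi / M) :
      0 ≤ ∑ k ∈ range M, extremalCoeff M k * Real.sin (k * x) := by
    have hd : Real.cos x - Real.cos (Real.pi / M) ≠ 0 := fun h =>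
      hx (Real.injOn_cos ⟨hx0.le, hxπ.le⟩ ⟨hy0.le, hyπ.le⟩ (sub_eq_zero.1 h))
    have hc : -1 < Real.cos x := by
      rw [← Real.cos_pi]
      exact Real.cos_lt_cos_of_nonneg_of_le_pi hx0.le le_rfl hxπ
    have hpos : 0 < 2 * (Real.cos x - Real.cos (Real.pi / M)) ^ 2 * (1 + Real.cos x) :=
      mul_pos (by positivity) (by linarith)
    refine nonneg_of_mul_nonneg_right ?_ hpos
    rw [two_mul_mul_sum_extremalCoeff_mul_sin hM]
    have h₁ := (Real.sin_pos_of_pos_of_lt_pi hx0 hxπ).le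
    have h₂ : 0 ≤ 1 + Real.cos (M * x) := by linarith [Real.neg_one_le_cos (M * x)]
    positivity
  rcases ht.1.eq_or_lt with rfl | ht0
  · simp
  rcases ht.2.eq_or_lt with rfl | htπ
  · simp [Real.sin_nat_mul_pi]
  rcases eq_or_ne t (Real.pi / M) with rfl | hty
  · have hcont : Continuous fun x : ℝ => ∑ k ∈ range M, extremalCoeff M k * Real.sin (k * x) := by
      fun_prop
    refine ge_of_tendsto ((hcont.tendsto (Real.pi / M)).mono_left
      (nhdsWithin_le_nhds (s := {Real.pi / M}ᶜ))) ?_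
    filter_upwards [self_mem_nhdsWithin, nhdsWithin_le_nhds (Ioo_mem_nhds ht0 htπ)] with x hx hx'
    exact off_node x hx'.1 hx'.2 hx
  · exact off_node t ht0 htπ hty

theorem sin_mul_sineSum_nonneg {s : Finset ℕ} {b : ℕ → ℝ}
    (hb : ∀ t ∈ Set.Icc (0 : ℝ) Real.pi, 0 ≤ ∑ j ∈ s, b j * Real.sin (j * t)) {t : ℝ}
    (ht0 : 0 ≤ t) (ht : t ≤ 2 * Real.pi) :
    0 ≤ Real.sin t * ∑ j ∈ s, b j * Real.sin (j * t) := by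
  rcases le_total t Real.pi with h | h
  · exact mul_nonneg (Real.sin_nonneg_of_nonneg_of_le_pi ht0 h) (hb t ⟨ht0, h⟩)
  · have h₁ := hb (2 * Real.pi - t) ⟨by linarith, by linarith⟩
    have h₂ : Real.sin (2 * Real.pi - t) = -Real.sin t := Real.sin_two_pi_sub t
    have h₃ : 0 ≤ Real.sin (2 * Real.pi - t) :=
      Real.sin_nonneg_of_nonneg_of_le_pi (by linarith) (by linarith)
    have h₄ : ∑ j ∈ s, b j * Real.sin (j * (2 * Real.pi - t)) =
        -∑ j ∈ s, b j * Real.sin (j * t) := by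
      rw [← sum_neg_distrib]
      refine sum_congr rfl fun j _ => ?_
      rw [mul_sub, Real.sin_nat_mul_two_pi_sub]
      ring
    rw [h₄] at h₁
    rw [h₂] at h₃
    nlinarith

theorem cos_le_cos_of_le_of_le_two_pi_sub {y t : ℝ} (hy : 0 ≤ y) (h₁ : y ≤ t)
    (h₂ : t ≤ 2 * Real.pi - y) : Real.cos t ≤ Real.cos y := by
  rcases le_total t Real.pi with h | h
  · exact Real.cos_le_cos_of_nonneg_of_le_pi hy h h₁
  · rw [← Real.cos_two_pi_sub t]
    exact Real.cos_le_cos_of_nonneg_of_le_pi hy (by linarith) (by linarith)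

section Nodes

variable {N m : ℕ}

theorem node_bounds (hm : m < N + 2) :
    Real.pi / (N + 2 : ℕ) ≤ (2 * m + 1) * (Real.pi / (N + 2 : ℕ)) ∧
      (2 * m + 1) * (Real.pi / (N + 2 : ℕ)) ≤ 2 * Real.pi - Real.pi / (N + 2 : ℕ) := by
  have hy : 0 < Real.pi / (N + 2 : ℕ) := by positivity
  have hπ : Real.pi = (N + 2 : ℕ) * (Real.pi / (N + 2 : ℕ)) := by field_simp
  have hm' : (m : ℝ) + 1 ≤ (N + 2 : ℕ) := by exact_mod_cast hm
  generalize Real.pi / (N + 2 : ℕ) = y at *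
  have hm0 : (0 : ℝ) ≤ m := m.cast_nonneg
  constructor <;> nlinarith

theorem cos_mul_node :
    Real.cos ((N + 2 : ℕ) * ((2 * m + 1) * (Real.pi / (N + 2 : ℕ)))) = -1 := by
  rw [show ((N + 2 : ℕ) : ℝ) * ((2 * m + 1) * (Real.pi / (N + 2 : ℕ))) =
    Real.pi + m * (2 * Real.pi) by field_simp; ring, Real.cos_add_nat_mul_two_pi, Real.cos_pi]

theorem cos_pi_div_lt_one : Real.cos (Real.pi / (N + 2 : ℕ)) < 1 := by
  have hN : (1 : ℝ) < (N + 2 : ℕ) := by exact_mod_cast (by omega : 1 < N + 2)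
  rw [← Real.cos_zero]
  exact Real.cos_lt_cos_of_nonneg_of_le_pi le_rfl (div_lt_self Real.pi_pos hN).le (by positivity)

theorem cos_node_lt_one (hm : m < N + 2) :
    Real.cos ((2 * m + 1) * (Real.pi / (N + 2 : ℕ))) < 1 :=
  (cos_le_cos_of_le_of_le_two_pi_sub (by positivity) (node_bounds hm).1 (node_bounds hm).2).trans_lt
    cos_pi_div_lt_one

theorem quadWeight_node_mul (hm : m < N + 2) (S : ℝ) :
    ∃ c : ℝ, 0 < c ∧
      quadWeight (N + 2) (1 / (2 * (1 - Real.cos (Real.pi / (N + 2 : ℕ)))))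
        ((2 * m + 1) * (Real.pi / (N + 2 : ℕ))) * S =
      c * ((Real.cos (Real.pi / (N + 2 : ℕ)) - Real.cos ((2 * m + 1) * (Real.pi / (N + 2 : ℕ)))) *
        (Real.sin ((2 * m + 1) * (Real.pi / (N + 2 : ℕ))) * S)) := by
  have h := quadWeight_mul (by omega) (cos_mul_node (N := N) (m := m))
    (cos_pi_div_lt_one (N := N)).ne
  have h₁ := sub_pos.2 (cos_node_lt_one hm)
  have h₂ := sub_pos.2 (cos_pi_div_lt_one (N := N))
  refine ⟨_, inv_pos.2 (mul_pos h₁ h₂), ?_⟩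
  rw [eq_inv_mul_iff_mul_eq₀ (mul_pos h₁ h₂).ne']
  linear_combination S * h

end Nodes

theorem sum_le_of_sineSum_nonneg {N : ℕ} (hN : 0 < N) {b : ℕ → ℝ}
    (hb : ∀ t ∈ Set.Icc (0 : ℝ) Real.pi, 0 ≤ ∑ j ∈ Icc 1 N, b j * Real.sin (j * t)) :
    ∑ j ∈ Icc 1 N, b j ≤ 1 / (2 * (1 - Real.cos (Real.pi / (N + 2 : ℕ)))) * b 1 := by
  have h := sum_quadWeight_mul hN (1 / (2 * (1 - Real.cos (Real.pi / (N + 2 : ℕ))))) b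
  refine sub_nonneg.1 (nonneg_of_mul_nonneg_right (h ▸ sum_nonneg fun m hm => ?_)
    (by positivity : (0 : ℝ) < (N + 2 : ℕ)))
  rw [mem_range] at hm
  obtain ⟨h₁, h₂⟩ := node_bounds hm
  have hy : 0 < Real.pi / (N + 2 : ℕ) := by positivity
  obtain ⟨c, hc, hw⟩ := quadWeight_node_mul hm
    (∑ j ∈ Icc 1 N, b j * Real.sin (j * ((2 * m + 1) * (Real.pi / (N + 2 : ℕ)))))
  rw [hw]
  exact mul_nonneg hc.le (mul_nonneg
    (sub_nonneg.2 (cos_le_cos_of_le_of_le_two_pi_sub hy.le h₁ h₂))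
    (sin_mul_sineSum_nonneg hb (by linarith) (by linarith)))

theorem sum_range_extremalCoeff_mul {N : ℕ} (hN : Odd N) (t : ℝ) :
    ∑ k ∈ range (N + 2), extremalCoeff (N + 2) k * Real.sin (k * t) =
      ∑ k ∈ Icc 1 N, extremalCoeff (N + 2) k * Real.sin (k * t) := by
  have hlast : extremalCoeff (N + 2) (N + 1) = 0 := by
    have harg : ((N + 1 : ℕ) : ℝ) * (Real.pi / (N + 2 : ℕ)) =
        Real.pi - 2 * (Real.pi / (N + 2 : ℕ) / 2) := by push_cast; field_simp; ring
    rw [extremalCoeff, harg, Real.sin_pi_sub, Real.cos_pi_sub, Real.sin_two_mul, Real.cos_two_mul,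
      hN.add_one.neg_one_pow]
    push_cast
    ring
  rw [sum_range_succ, hlast, zero_mul, add_zero, sum_range_succ', Nat.cast_zero, zero_mul,
    Real.sin_zero, mul_zero, add_zero, range_eq_Ico, sum_Ico_add' (fun k : ℕ =>
      extremalCoeff (N + 2) k * Real.sin (k * t)) 0 N 1]
  rfl

theorem sum_extremalCoeff {N : ℕ} (hN : Odd N) :
    ∑ k ∈ Icc 1 N, extremalCoeff (N + 2) k =
      1 / (2 * (1 - Real.cos (Real.pi / (N + 2 : ℕ)))) * extremalCoeff (N + 2) 1 := by
  have h := sum_quadWeight_mul hN.pos (1 / (2 * (1 - Real.cos (Real.pi / (N + 2 : ℕ)))))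
    (extremalCoeff (N + 2))
  rw [sum_eq_zero fun m hm => ?_, eq_comm, mul_eq_zero, sub_eq_zero] at h
  · exact (h.resolve_left (by positivity)).symm
  · obtain ⟨c, -, hw⟩ := quadWeight_node_mul (mem_range.1 hm) (∑ j ∈ Icc 1 N,
      extremalCoeff (N + 2) j * Real.sin (j * ((2 * m + 1) * (Real.pi / (N + 2 : ℕ)))))
    have hS := two_mul_mul_sum_extremalCoeff_mul_sin (hN.add_even even_two)
      ((2 * m + 1) * (Real.pi / (N + 2 : ℕ)))
    rw [cos_mul_node, add_neg_cancel, mul_zero, mul_zero, sum_range_extremalCoeff_mul hN] at hS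
    rw [hw]
    have hsc := Real.sin_sq_add_cos_sq ((2 * m + 1) * (Real.pi / (N + 2 : ℕ)))
    generalize (2 * (m : ℝ) + 1) * (Real.pi / (N + 2 : ℕ)) = t at *
    simp only [mul_eq_zero, pow_eq_zero_iff two_ne_zero, two_ne_zero, false_or] at hS
    rcases hS with (hS | hS) | hS
    · rw [← neg_sub, hS]; simp
    · have : Real.sin t = 0 := by
        have hc : Real.cos t = -1 := by linarith
        rw [hc] at hsc
        simpa using hsc
      simp [this]
    · simp [hS]

theorem stmt17 (N : ℕ) (hN : 0 < N) (hNodd : Odd N)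
    (μ : ℝ) (hμ : μ = Real.sin (Real.pi / (2 * (N + 2))))
    (α : ℕ → ℝ)
    (hα : ∀ k : ℕ, 1 ≤ k → k ≤ N →
      α k = (-1 : ℝ) ^ (k - 1) * Ucheb' ((N : ℤ) - k + 1) μ * Ucheb ((k : ℤ) - 1) μ
              / Ucheb' (N : ℤ) μ) :
    α 1 = 1
      ∧ (∀ t ∈ Set.Icc (0 : ℝ) Real.pi, 0 ≤ ∑ j ∈ Finset.Icc 1 N, α j * Real.sin (j * t))
      ∧ ∑ k ∈ Finset.Icc 1 N, α k = (1 / 4) * (1 / Real.sin (Real.pi / (2 * (N + 2))) ^ 2)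
      ∧ ∀ b : ℕ → ℝ, b 1 = 1 →
          (∀ t ∈ Set.Icc (0 : ℝ) Real.pi, 0 ≤ ∑ j ∈ Finset.Icc 1 N, b j * Real.sin (j * t)) →
          ∑ j ∈ Finset.Icc 1 N, b j ≤ ∑ j ∈ Finset.Icc 1 N, α j := by
  have hM : Odd (N + 2) := hNodd.add_even even_two
  have hcast : ((N + 2 : ℕ) : ℝ) = N + 2 := by push_cast; ring
  have hy : Real.pi / (2 * (N + 2)) = Real.pi / (N + 2 : ℕ) / 2 := by
    rw [hcast]; field_simp
  rw [hy] at hμ ⊢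
  set a := extremalCoeff (N + 2) with ha
  have ha1 : 0 < a 1 := extremalCoeff_one_pos (by omega)
  obtain ⟨r, hr⟩ := hM
  have hcoeff (k : ℕ) (hk : 1 ≤ k) : a k =
      -2 * (-1) ^ r * Real.cos (Real.pi / (N + 2 : ℕ) / 2) ^ 4 *
        ((-1) ^ (k - 1) * Ucheb' ((N : ℤ) - k + 1) μ * Ucheb ((k : ℤ) - 1) μ) := by
    rw [ha, hr, extremalCoeff_eq_Ucheb r k hk, hμ, ← hr,
      show (2 * (r : ℤ) + 1 - k - 1) = N - k + 1 by omega]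
  have hα' (k : ℕ) (hk : k ∈ Icc 1 N) : α k = a k / a 1 := by
    obtain ⟨hk1, hkN⟩ := mem_Icc.1 hk
    have h1 := hcoeff 1 le_rfl
    simp only [Nat.sub_self, pow_zero, Nat.cast_one, sub_self, sub_add_cancel, one_mul] at h1
    rw [show Ucheb 0 μ = 1 by simp [Ucheb], mul_one] at h1
    rw [hα k hk1 hkN, hcoeff k hk1, h1, mul_div_mul_left]
    rintro h0
    rw [h0, zero_mul] at h1
    exact ha1.ne' h1
  have hα1 : α 1 = 1 := by
    rw [hα' 1 (mem_Icc.2 ⟨le_rfl, hN⟩), div_self ha1.ne']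
  have hl : 1 / (2 * (1 - Real.cos (Real.pi / (N + 2 : ℕ)))) =
      (1 / 4) * (1 / Real.sin (Real.pi / (N + 2 : ℕ) / 2) ^ 2) := by
    rw [Real.sin_sq_eq_half_sub, mul_div_cancel₀ _ two_ne_zero]
    have := sub_pos.2 (cos_pi_div_lt_one (N := N))
    field_simp
    norm_num
  have hsum : ∑ k ∈ Icc 1 N, α k =
      (1 / 4) * (1 / Real.sin (Real.pi / (N + 2 : ℕ) / 2) ^ 2) := by
    rw [sum_congr rfl hα', ← sum_div, sum_extremalCoeff hNodd, mul_div_cancel_right₀ _ ha1.ne', hl]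
  refine ⟨hα1, fun t ht => ?_, hsum, fun b hb1 hb => ?_⟩
  · rw [sum_congr rfl fun k hk => by rw [hα' k hk, div_mul_eq_mul_div], ← sum_div,
      ← sum_range_extremalCoeff_mul hNodd]
    exact div_nonneg (sum_extremalCoeff_mul_sin_nonneg ⟨r, hr⟩ (by omega) ht) ha1.le
  · rw [hsum, ← hl]
    simpa [hb1] using sum_le_of_sineSum_nonneg hN hb
end

section
/- Let N be an even positive integer with N ≥ 4, let ν be the least positive root of U'_{N+1}(x), and for k = 1,…,N let z_k = (−1)^{k−1}( U_{k−1}(ν)U_k(ν) − U_{N−k}(ν)U_{N−k+1}(ν) + ((N+1−2k)/(N+1)) U_N(ν)U_{N+1}(ν) ). Set β² = ∑_{j=1}^N z_j² − ∑_{j=1}^{N−2} z_j z_{j+2}, and define α_k = ( ∑_{j=1}^{N−k+1} z_j z_{j+k−1} − ∑_{j=1}^{N−k−1} z_j z_{j+k+1} )/β² for k = 1,…,N−2, α_{N−1} = (z_1 z_{N−1} + z_2 z_N)/β², and α_N = z_1 z_N / β². Then α_k > 0 for every k = 1,…,N. -/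
/-- A sum over an integer interval containing the support `{k + 1, …, k + L}` of `f`, reindexed by
the natural numbers `1, …, L`. -/
lemma sum_int_Icc_eq_sum_nat_Icc (f : ℤ → ℝ) (a b : ℤ) (k L : ℕ)
    (hf : ∀ m, f m ≠ 0 → (k : ℤ) + 1 ≤ m ∧ m ≤ k + L) (ha : a ≤ k + 1) (hb : (k : ℤ) + L ≤ b) :
    ∑ m ∈ Finset.Icc a b, f m = ∑ j ∈ Finset.Icc 1 L, f ((j : ℤ) + k) := by
  symm
  refine Finset.sum_of_injOn (fun j : ℕ => (j : ℤ) + k) ?_ ?_ ?_ ?_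
  · intro i _ j _ hij
    simpa using hij
  · intro j hj
    simp only [Finset.coe_Icc, Set.mem_Icc] at hj ⊢
    omega
  · intro m _ hm
    by_contra h
    obtain ⟨h1, h2⟩ := hf m h
    refine hm ⟨(m - k).toNat, ?_, ?_⟩
    · simp only [Finset.coe_Icc, Set.mem_Icc]
      omega
    · simp only
      omega
  · intro j _
    rfl

/-- If `Z` decreases with the distance to `(N + 1) / 2`, then its autocorrelation strictly
decreases under steps of length two inside the support. -/
lemma sum_mul_sub_pos (Z : ℤ → ℝ) (N k : ℕ) (hk : 1 ≤ k) (hkN : k ≤ N)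
    (hmono : ∀ i j : ℤ, |2 * j - (N + 1)| ≤ |2 * i - (N + 1)| → Z i ≤ Z j)
    (hzero : ∀ i : ℤ, i ≤ 0 → Z i = 0) (hpos : 0 < Z 1) :
    0 < ∑ m ∈ Finset.Icc (-2 * N : ℤ) (3 * N + 1), Z (m - k) * (Z (m - 1) - Z (m + 1)) := by
  have hsymm : ∀ i j : ℤ, i + j = N + 1 → Z i = Z j := by
    intro i j hij
    have : 2 * j - (N + 1 : ℤ) = -(2 * i - (N + 1)) := by linarith
    apply le_antisymm <;> apply hmono <;> rw [this, abs_neg]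
  have hrefl : ∑ m ∈ Finset.Icc (-2 * N : ℤ) (3 * N + 1), Z (m - k) * (Z (m - 1) - Z (m + 1))
      = ∑ m ∈ Finset.Icc (-2 * N : ℤ) (3 * N + 1),
        Z (N + 1 - m - k) * (Z (m + 1) - Z (m - 1)) := by
    refine Finset.sum_nbij' (fun m => N + 1 - m) (fun m => N + 1 - m) ?_ ?_ ?_ ?_ ?_
    · intro m hm
      simp only [Finset.mem_Icc] at hm ⊢
      omega
    · intro m hm
      simp only [Finset.mem_Icc] at hm ⊢
      omega
    · intro m _
      ring
    · intro m _
      ring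
    · intro m _
      rw [hsymm (m - 1) (N + 1 - m + 1) (by ring), hsymm (m + 1) (N + 1 - m - 1) (by ring)]
      congr 2
      ring
  have hdouble : 0 < ∑ m ∈ Finset.Icc (-2 * N : ℤ) (3 * N + 1),
      (Z (m - k) - Z (N + 1 - m - k)) * (Z (m - 1) - Z (m + 1)) := by
    refine Finset.sum_pos' ?_ ⟨N + 1, ?_, ?_⟩
    · intro m _
      rcases le_total ((N : ℤ) + 1) (2 * m) with h | h
      · refine mul_nonneg (sub_nonneg.2 (hmono _ _ ?_)) (sub_nonneg.2 (hmono _ _ ?_)) <;> grind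
      · refine mul_nonneg_of_nonpos_of_nonpos (sub_nonpos.2 (hmono _ _ ?_))
          (sub_nonpos.2 (hmono _ _ ?_)) <;> grind
    · simp only [Finset.mem_Icc]
      omega
    · have h1 : 0 < Z ((N : ℤ) + 1 - k) := hpos.trans_le (hmono _ _ (by grind))
      rw [hzero ((N : ℤ) + 1 - (N + 1) - k) (by omega), hsymm ((N : ℤ) + 1 - 1) 1 (by ring),
        hsymm ((N : ℤ) + 1 + 1) (-1) (by ring), hzero (-1) (by norm_num)]
      simpa using mul_pos h1 hpos
  have hsum : ∑ m ∈ Finset.Icc (-2 * N : ℤ) (3 * N + 1),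
      (Z (m - k) - Z (N + 1 - m - k)) * (Z (m - 1) - Z (m + 1))
      = ∑ m ∈ Finset.Icc (-2 * N : ℤ) (3 * N + 1), Z (m - k) * (Z (m - 1) - Z (m + 1))
        + ∑ m ∈ Finset.Icc (-2 * N : ℤ) (3 * N + 1),
          Z (N + 1 - m - k) * (Z (m + 1) - Z (m - 1)) := by
    rw [← Finset.sum_add_distrib]
    exact Finset.sum_congr rfl fun m _ => by ring
  linarith

/-- The autocorrelation of a positive, symmetric, unimodal finite sequence strictly decreases
under steps of length two. -/
lemma autocorrelation_sub_pos (z : ℕ → ℝ) (N r k : ℕ) (hN : N = 2 * r) (hk : 1 ≤ k) (hkN : k ≤ N)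
    (hsymm : ∀ i, 1 ≤ i → i ≤ N → z (N + 1 - i) = z i) (hpos : 0 < z 1)
    (hstep : ∀ i, 1 ≤ i → i + 1 ≤ r → z i ≤ z (i + 1)) :
    0 < ∑ j ∈ Finset.Icc 1 (N - k + 1), z j * z (j + k - 1)
      - ∑ j ∈ Finset.Icc 1 (N - k - 1), z j * z (j + k + 1) := by
  have hmono : ∀ i j, 1 ≤ i → i ≤ j → j ≤ r → z i ≤ z j := by
    intro i j hi hij
    induction j, hij using Nat.le_induction with
    | base => exact fun _ => le_rfl
    | succ j hij ih => exact fun hj => (ih (by omega)).trans (hstep j (by omega) hj)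
  set Z : ℤ → ℝ := fun i => if 1 ≤ i ∧ i ≤ N then z i.toNat else 0 with hZ
  have hZin : ∀ (i : ℤ) (j : ℕ), i = j → 1 ≤ j → j ≤ N → Z i = z j := by
    intro i j hij h1 h2
    subst hij
    simp only [hZ]
    rw [if_pos (by omega), Int.toNat_natCast]
  have hZout : ∀ i : ℤ, ¬ (1 ≤ i ∧ i ≤ N) → Z i = 0 := fun i hi => if_neg hi
  have hZfold : ∀ i : ℤ, 1 ≤ i → i ≤ N →
      ∃ j : ℕ, 1 ≤ j ∧ j ≤ r ∧ Z i = z j ∧ |2 * i - (N + 1)| = N + 1 - 2 * j := by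
    intro i h1 h2
    by_cases h : i ≤ r
    · refine ⟨i.toNat, by omega, by omega, hZin _ _ (by omega) (by omega) (by omega), ?_⟩
      rw [abs_of_nonpos (by omega)]
      omega
    · refine ⟨N + 1 - i.toNat, by omega, by omega, ?_, ?_⟩
      · rw [hsymm _ (by omega) (by omega)]
        exact hZin _ _ (by omega) (by omega) (by omega)
      · rw [abs_of_nonneg (by omega)]
        omega
  have key := sum_mul_sub_pos Z N k hk hkN ?_ (fun i hi => hZout i (by omega)) ?_
  · have h1 := sum_int_Icc_eq_sum_nat_Icc (fun m => Z (m - k) * Z (m - 1)) (-2 * N) (3 * N + 1) k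
      (N - k + 1) ?_ (by omega) (by omega)
    · have h2 := sum_int_Icc_eq_sum_nat_Icc (fun m => Z (m - k) * Z (m + 1)) (-2 * N) (3 * N + 1) k
        (N - k - 1) ?_ (by omega) (by omega)
      · simp only [mul_sub, Finset.sum_sub_distrib] at key
        rw [h1, h2] at key
        refine key.trans_eq (congrArg₂ _ (Finset.sum_congr rfl ?_) (Finset.sum_congr rfl ?_))
        · intro j hj
          rw [Finset.mem_Icc] at hj
          rw [hZin _ j (by omega) (by omega) (by omega),
            hZin _ (j + k - 1) (by omega) (by omega) (by omega)]
        · intro j hj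
          rw [Finset.mem_Icc] at hj
          rw [hZin _ j (by omega) (by omega) (by omega),
            hZin _ (j + k + 1) (by omega) (by omega) (by omega)]
      · intro m hm
        have ha := not_imp_comm.1 (hZout _) (left_ne_zero_of_mul hm)
        have hb := not_imp_comm.1 (hZout _) (right_ne_zero_of_mul hm)
        omega
    · intro m hm
      have ha := not_imp_comm.1 (hZout _) (left_ne_zero_of_mul hm)
      have hb := not_imp_comm.1 (hZout _) (right_ne_zero_of_mul hm)
      omega
  · intro i j hij
    by_cases hi : 1 ≤ i ∧ i ≤ N
    · have hj : 1 ≤ j ∧ j ≤ N := by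
        clear * - hij hi
        grind
      obtain ⟨i', hi1, _, hi3, hi4⟩ := hZfold i hi.1 hi.2
      obtain ⟨j', _, hj2, hj3, hj4⟩ := hZfold j hj.1 hj.2
      rw [hi3, hj3]
      exact hmono _ _ hi1 (by omega) hj2
    · rw [hZout i hi]
      by_cases hj : 1 ≤ j ∧ j ≤ N
      · obtain ⟨j', hj1, hj2, hj3, _⟩ := hZfold j hj.1 hj.2
        rw [hj3]
        exact hpos.le.trans (hmono _ _ le_rfl hj1 hj2)
      · rw [hZout j hj]
  · rwa [hZin 1 1 rfl le_rfl (by omega)]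

lemma Ucheb_cos_mul_sin (n : ℤ) (t : ℝ) :
    Ucheb n (Real.cos t) * Real.sin t = Real.sin ((n + 1) * t) :=
  Polynomial.Chebyshev.U_real_cos t n

lemma Ucheb'_cos_mul_sin_pow (n : ℤ) (t : ℝ) :
    Ucheb' n (Real.cos t) * Real.sin t ^ 3
      = Real.sin ((n + 1) * t) * Real.cos t - (n + 1) * Real.cos ((n + 1) * t) * Real.sin t := by
  have h1 : HasDerivAt (fun t => Ucheb n (Real.cos t) * Real.sin t)
      (Ucheb' n (Real.cos t) * (-Real.sin t) * Real.sin t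
        + Ucheb n (Real.cos t) * Real.cos t) t :=
    (((Polynomial.Chebyshev.U ℝ n).hasDerivAt (Real.cos t)).comp t
      (Real.hasDerivAt_cos t)).mul (Real.hasDerivAt_sin t)
  have h2 : HasDerivAt (fun t : ℝ => Real.sin ((n + 1) * t))
      (Real.cos ((n + 1) * t) * ((n + 1) * 1)) t :=
    ((hasDerivAt_id t).const_mul ((n : ℝ) + 1)).sin
  have h3 : (fun t => Ucheb n (Real.cos t) * Real.sin t)
      = fun t : ℝ => Real.sin ((n + 1) * t) := funext (Ucheb_cos_mul_sin n)
  rw [h3] at h1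
  have h4 := h1.unique h2
  have h5 := Ucheb_cos_mul_sin n t
  linear_combination (-Real.sin t) * h4 + Real.cos t * h5

lemma sin_odd_mul_pi_div_two_sub (a : ℕ) (s : ℝ) :
    Real.sin ((2 * a + 1) * (Real.pi / 2 - s)) = (-1) ^ a * Real.cos ((2 * a + 1) * s) := by
  rw [show (2 * a + 1) * (Real.pi / 2 - s) = (Real.pi / 2 - (2 * a + 1) * s) + a * Real.pi by ring,
    Real.sin_add_nat_mul_pi, Real.sin_pi_div_two_sub]

lemma sin_even_mul_pi_div_two_sub (a : ℕ) (s : ℝ) :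
    Real.sin (2 * a * (Real.pi / 2 - s)) = -((-1) ^ a * Real.sin (2 * a * s)) := by
  rw [show 2 * a * (Real.pi / 2 - s) = -(2 * a * s) + a * Real.pi by ring,
    Real.sin_add_nat_mul_pi, Real.sin_neg]
  ring

lemma cos_even_mul_pi_div_two_sub (a : ℕ) (s : ℝ) :
    Real.cos (2 * a * (Real.pi / 2 - s)) = (-1) ^ a * Real.cos (2 * a * s) := by
  rw [show 2 * a * (Real.pi / 2 - s) = -(2 * a * s) + a * Real.pi by ring,
    Real.cos_add_nat_mul_pi, Real.cos_neg]

/-- `U'_{2r+1}(sin s)` in trigonometric form. -/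
lemma Ucheb'_sin_mul_cos_pow (r : ℕ) (s : ℝ) :
    Ucheb' (2 * r + 1) (Real.sin s) * Real.cos s ^ 3
      = (-1) ^ r * (2 * (r + 1) * Real.cos (2 * (r + 1) * s) * Real.cos s
        + Real.sin (2 * (r + 1) * s) * Real.sin s) := by
  have h := Ucheb'_cos_mul_sin_pow (2 * r + 1) (Real.pi / 2 - s)
  have hs := sin_even_mul_pi_div_two_sub (r + 1) s
  have hc := cos_even_mul_pi_div_two_sub (r + 1) s
  push_cast at h hs hc
  rw [show (2 * (r : ℝ) + 1 + 1) = 2 * (r + 1) by ring, hs, hc, Real.cos_pi_div_two_sub,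
    Real.sin_pi_div_two_sub] at h
  rw [h]
  ring

lemma zCoord_reflect (N i : ℕ) (hN : Even N) (h1 : 1 ≤ i) (h2 : i ≤ N) (x : ℝ) :
    zCoord N (N + 1 - i) x = zCoord N i x := by
  have hpow : (-1 : ℝ) ^ (N + 1 - i - 1) = -(-1) ^ (i - 1) := by
    obtain ⟨j, rfl⟩ : ∃ j, i = j + 1 := ⟨i - 1, by omega⟩
    have h : (-1 : ℝ) ^ (N + 1 - (j + 1) - 1) * (-1) ^ (j + 1) = 1 := by
      rw [← pow_add, show N + 1 - (j + 1) - 1 + (j + 1) = N by omega, hN.neg_one_pow]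
    have hj : ((-1 : ℝ) ^ j) ^ 2 = 1 := by rw [← pow_mul, mul_comm, pow_mul]; simp
    rw [Nat.add_sub_cancel]
    linear_combination -(-1 : ℝ) ^ j * h - (-1 : ℝ) ^ (N + 1 - (j + 1) - 1) * hj
  unfold zCoord
  rw [hpow, Nat.cast_sub (by omega), Nat.cast_sub (by omega)]
  push_cast
  rw [show (N : ℤ) + 1 - i - 1 = N - i by ring, show (N : ℤ) - (N + 1 - i) = i - 1 by ring,
    show (i : ℤ) - 1 + 1 = i by ring, show (N : ℤ) + 1 - i = N - i + 1 by ring]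
  ring

lemma zCoord_cos_mul_sin_sq (N k : ℕ) (t : ℝ) :
    zCoord N k (Real.cos t) * Real.sin t ^ 2
      = (-1) ^ (k - 1) * Real.sin ((N + 2) * t) *
        ((N + 1 - 2 * k) / (N + 1) * Real.sin ((N + 1) * t)
          - Real.sin ((N + 1 - 2 * k) * t)) := by
  have e1 := Ucheb_cos_mul_sin ((k : ℤ) - 1) t
  have e2 := Ucheb_cos_mul_sin (k : ℤ) t
  have e3 := Ucheb_cos_mul_sin ((N : ℤ) - k) t
  have e4 := Ucheb_cos_mul_sin ((N : ℤ) - k + 1) t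
  have e5 := Ucheb_cos_mul_sin (N : ℤ) t
  have e6 := Ucheb_cos_mul_sin ((N : ℤ) + 1) t
  push_cast at e1 e2 e3 e4 e5 e6
  rw [show (k : ℝ) - 1 + 1 = k by ring] at e1
  rw [show (N : ℝ) + 1 + 1 = N + 2 by ring] at e6
  have hprod : Real.sin (k * t) * Real.sin ((k + 1) * t)
      - Real.sin ((N - k + 1) * t) * Real.sin ((N - k + 1 + 1) * t)
      = -(Real.sin ((N + 2) * t) * Real.sin ((N + 1 - 2 * k) * t)) := by
    have key : ∀ a b : ℝ, 2 * (Real.sin a * Real.sin b) = Real.cos (a - b) - Real.cos (a + b) := by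
      intro a b
      rw [Real.cos_sub, Real.cos_add]
      ring
    have k1 := key ((k + 1) * t) (k * t)
    have k2 := key ((N - k + 1 + 1) * t) ((N - k + 1) * t)
    have k3 := key ((N + 2) * t) ((N + 1 - 2 * k) * t)
    ring_nf at k1 k2 k3 ⊢
    linarith
  unfold zCoord
  rw [← e1, ← e2, ← e3, ← e4] at hprod
  rw [← e5]
  linear_combination (-1 : ℝ) ^ (k - 1) * hprod + (-1 : ℝ) ^ (k - 1) *
    ((N + 1 - 2 * k) / (N + 1)) * Ucheb (N : ℤ) (Real.cos t) * Real.sin t * e6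

lemma zCoord_sin_mul_cos_sq (r k : ℕ) (h1 : 1 ≤ k) (h2 : k ≤ r) (s : ℝ) :
    zCoord (2 * r) k (Real.sin s) * Real.cos s ^ 2
      = Real.sin (2 * (r + 1) * s) * (Real.cos ((2 * r + 1 - 2 * k) * s)
        - (-1) ^ k * ((2 * r + 1 - 2 * k) / (2 * r + 1)) * Real.cos ((2 * r + 1) * s)) := by
  have h := zCoord_cos_mul_sin_sq (2 * r) k (Real.pi / 2 - s)
  have ha := sin_even_mul_pi_div_two_sub (r + 1) s
  have hb := sin_odd_mul_pi_div_two_sub r s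
  have hc := sin_odd_mul_pi_div_two_sub (r - k) s
  rw [Nat.cast_sub h2] at hc
  rw [show (2 * ((r : ℝ) - k) + 1) = 2 * r + 1 - 2 * k by ring] at hc
  push_cast at h ha
  rw [show (2 * (r : ℝ) + 2) = 2 * (r + 1) by ring, ha, hb, hc, Real.cos_pi_div_two_sub,
    Real.sin_pi_div_two_sub] at h
  rw [h]
  obtain ⟨a, rfl⟩ : ∃ a, r = k + a := ⟨r - k, by omega⟩
  obtain ⟨b, rfl⟩ : ∃ b, k = b + 1 := ⟨k - 1, by omega⟩
  simp only [Nat.add_sub_cancel, Nat.add_sub_cancel_left, pow_add, pow_one]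
  rcases neg_one_pow_eq_or ℝ a with ha' | ha' <;> rcases neg_one_pow_eq_or ℝ b with hb' | hb' <;>
    rw [ha', hb'] <;> ring

/-- The least positive root of `U'_{2r+1}` is `sin s` with `2 (r + 1) s < π`. -/
lemma exists_eq_sin_of_least_root (r : ℕ) (hr : 1 ≤ r) (ν : ℝ) (hν0 : 0 < ν)
    (hνleast : ∀ x : ℝ, 0 < x → x < ν → Ucheb' (2 * r + 1) x ≠ 0) :
    ∃ s : ℝ, 0 < s ∧ 2 * (r + 1) * s < Real.pi ∧ ν = Real.sin s := by
  have hr' : (1 : ℝ) ≤ r := by exact_mod_cast hr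
  have hpi := Real.pi_pos
  set b : ℝ := Real.pi / (2 * (r + 1)) with hb
  have hb0 : 0 < b := by positivity
  have hMb : 2 * (r + 1) * b = Real.pi := by rw [hb]; field_simp
  have hb2 : b < Real.pi / 2 := by nlinarith
  have hcosb : 0 < Real.cos b := Real.cos_pos_of_mem_Ioo ⟨by linarith, hb2⟩
  have hcont : Continuous fun s : ℝ => 2 * (r + 1) * Real.cos (2 * (r + 1) * s) * Real.cos s
      + Real.sin (2 * (r + 1) * s) * Real.sin s := by fun_prop
  obtain ⟨s, ⟨hs0, hsb⟩, hs⟩ := intermediate_value_Ioo' hb0.le hcont.continuousOn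
    (show (0 : ℝ) ∈ Set.Ioo _ _ by
      simp only [hMb, Real.cos_pi, Real.sin_pi, mul_zero, Real.cos_zero, Real.sin_zero]
      constructor
      · nlinarith
      · linarith)
  have hcoss : 0 < Real.cos s := Real.cos_pos_of_mem_Ioo ⟨by linarith, by linarith⟩
  have hroot : Ucheb' (2 * r + 1) (Real.sin s) = 0 := by
    have h := Ucheb'_sin_mul_cos_pow r s
    simp only at hs
    rw [hs, mul_zero] at h
    exact (mul_eq_zero.1 h).resolve_right (by positivity)
  have hνs : ν ≤ Real.sin s := by
    by_contra! h
    exact hνleast _ (Real.sin_pos_of_pos_of_lt_pi hs0 (by linarith)) h hroot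
  have hle : Real.arcsin ν ≤ s := by
    rw [← Real.arcsin_sin (by linarith : -(Real.pi / 2) ≤ s) (by linarith)]
    exact Real.monotone_arcsin hνs
  refine ⟨Real.arcsin ν, Real.arcsin_pos.2 hν0, ?_,
    (Real.sin_arcsin (by linarith) (hνs.trans (Real.sin_le_one s))).symm⟩
  rw [← hMb]
  have : Real.arcsin ν < b := hle.trans_lt hsb
  gcongr

/-- Consequences of the root equation `M cos (M s) cos s + sin (M s) sin s = 0`, where
`M = 2 (r + 1)`, for the angle `(M - 1) s`. -/
lemma cos_pos_and_cos_le_of_root (r : ℕ) (hr : 2 ≤ r) (s : ℝ) (hs0 : 0 < s)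
    (hs : 2 * (r + 1) * s < Real.pi)
    (hroot : 2 * (r + 1) * Real.cos (2 * (r + 1) * s) * Real.cos s
      + Real.sin (2 * (r + 1) * s) * Real.sin s = 0) :
    0 < Real.cos ((2 * r + 1) * s) ∧
      Real.cos ((2 * r + 1) * s) ≤ Real.sin ((2 * r + 1) * s) * Real.sin s := by
  have hr' : (2 : ℝ) ≤ r := by exact_mod_cast hr
  have hσ : 0 < Real.sin s := Real.sin_pos_of_pos_of_lt_pi hs0 (by nlinarith)
  have hS : 0 < Real.sin ((2 * r + 1) * s) :=
    Real.sin_pos_of_pos_of_lt_pi (by positivity) (by nlinarith)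
  have hc : 0 < Real.cos s := Real.cos_pos_of_mem_Ioo ⟨by linarith [Real.pi_pos], by nlinarith⟩
  have hcs := Real.one_sub_sq_div_two_le_cos (x := s)
  have hc1 := Real.cos_le_one s
  have hsq := Real.sin_sq_add_cos_sq s
  have hs2 : (2 * r + 1) * s ^ 2 ≤ 2 := by
    have h1 : (2 * (r + 1) * s) ^ 2 ≤ 3.15 ^ 2 := by
      have := Real.pi_lt_d2
      gcongr
      linarith
    have h2 : (2 * (r + 1)) ^ 2 * ((2 * r + 1) * s ^ 2) ≤ (2 * ((r : ℝ) + 1)) ^ 2 * 2 := by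
      nlinarith
    exact le_of_mul_le_mul_left h2 (by positivity)
  rw [show 2 * ((r : ℝ) + 1) * s = (2 * r + 1) * s + s by ring, Real.cos_add,
    Real.sin_add] at hroot
  generalize Real.cos ((2 * r + 1) * s) = C at *
  generalize Real.sin ((2 * r + 1) * s) = S at *
  generalize Real.cos s = c at *
  generalize Real.sin s = σ at *
  have hD : 0 < 2 * (r + 1) * c ^ 2 + σ ^ 2 := by positivity
  have hC : C * (2 * (r + 1) * c ^ 2 + σ ^ 2) = (2 * r + 1) * c * (S * σ) := by
    linear_combination hroot
  have hDc : (2 * r + 1) * c ≤ 2 * (r + 1) * c ^ 2 + σ ^ 2 := by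
    have h1 : (2 * r + 1) * (1 - c) ≤ 1 := by nlinarith
    nlinarith
  constructor
  · exact pos_of_mul_pos_left (hC ▸ by positivity) hD.le
  · have h := mul_le_mul_of_nonneg_right hDc (mul_pos hS hσ).le
    rw [← hC, mul_comm] at h
    exact le_of_mul_le_mul_left h hD

lemma mul_sin_le_sin_mul (a x : ℝ) (ha0 : 0 ≤ a) (ha1 : a ≤ 1) (hx0 : 0 ≤ x)
    (hx : x ≤ Real.pi) : a * Real.sin x ≤ Real.sin (a * x) := by
  have h := strictConcaveOn_sin_Icc.concaveOn.2 (Set.mem_Icc.2 ⟨hx0, hx⟩)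
    (Set.mem_Icc.2 ⟨le_rfl, Real.pi_pos.le⟩) ha0 (sub_nonneg.2 ha1) (by ring)
  simpa using h

lemma zCoord_one_pos (r : ℕ) (hr : 2 ≤ r) (s : ℝ) (hs0 : 0 < s)
    (hs : 2 * (r + 1) * s < Real.pi)
    (hroot : 2 * (r + 1) * Real.cos (2 * (r + 1) * s) * Real.cos s
      + Real.sin (2 * (r + 1) * s) * Real.sin s = 0) :
    0 < zCoord (2 * r) 1 (Real.sin s) := by
  have hr' : (2 : ℝ) ≤ r := by exact_mod_cast hr
  obtain ⟨hC, -⟩ := cos_pos_and_cos_le_of_root r hr s hs0 hs hroot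
  have h := zCoord_sin_mul_cos_sq r 1 le_rfl (by omega) s
  have hM : 0 < Real.sin (2 * (r + 1) * s) := Real.sin_pos_of_pos_of_lt_pi (by positivity) hs
  have hcos : Real.cos ((2 * r + 1) * s) ≤ Real.cos ((2 * r + 1 - 2 * (1 : ℕ)) * s) := by
    push_cast
    apply Real.cos_le_cos_of_nonneg_of_le_pi <;> nlinarith
  have hq : 0 ≤ (2 * r + 1 - 2 * (1 : ℕ)) / (2 * (r : ℝ) + 1) := by
    push_cast
    exact div_nonneg (by linarith) (by linarith)
  refine pos_of_mul_pos_left (h ▸ mul_pos hM ?_) (sq_nonneg (Real.cos s))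
  have hqC := mul_nonneg hq hC.le
  rw [pow_one, neg_one_mul, neg_mul, sub_neg_eq_add]
  exact add_pos_of_pos_of_nonneg (hC.trans_le hcos) hqC

lemma zCoord_le_succ (r : ℕ) (hr : 2 ≤ r) (s : ℝ) (hs0 : 0 < s)
    (hs : 2 * (r + 1) * s < Real.pi)
    (hroot : 2 * (r + 1) * Real.cos (2 * (r + 1) * s) * Real.cos s
      + Real.sin (2 * (r + 1) * s) * Real.sin s = 0)
    (k : ℕ) (h1 : 1 ≤ k) (h2 : k + 1 ≤ r) :
    zCoord (2 * r) k (Real.sin s) ≤ zCoord (2 * r) (k + 1) (Real.sin s) := by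
  have hr' : (2 : ℝ) ≤ r := by exact_mod_cast hr
  have hk1 : (1 : ℝ) ≤ k := by exact_mod_cast h1
  have hk2 : (k : ℝ) + 1 ≤ r := by exact_mod_cast h2
  obtain ⟨hC, hCS⟩ := cos_pos_and_cos_le_of_root r hr s hs0 hs hroot
  have hM : 0 < Real.sin (2 * (r + 1) * s) := Real.sin_pos_of_pos_of_lt_pi (by positivity) hs
  have hc : 0 < Real.cos s := Real.cos_pos_of_mem_Ioo ⟨by linarith [Real.pi_pos], by nlinarith⟩
  have hσ : 0 < Real.sin s := Real.sin_pos_of_pos_of_lt_pi hs0 (by nlinarith)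
  have e1 := zCoord_sin_mul_cos_sq r k h1 (by omega) s
  have e2 := zCoord_sin_mul_cos_sq r (k + 1) (by omega) h2 s
  refine le_of_mul_le_mul_right ?_ (pow_pos hc 2)
  rw [e1, e2]
  refine mul_le_mul_of_nonneg_left ?_ hM.le
  set a : ℝ := (2 * r - 2 * k) / (2 * r + 1) with ha
  have ha0 : 0 ≤ a := div_nonneg (by linarith) (by linarith)
  have ha1 : a ≤ 1 := (div_le_one (by linarith)).2 (by linarith)
  have han : a * (2 * r + 1) = 2 * r - 2 * k := div_mul_cancel₀ _ (by linarith)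
  have hsin := mul_sin_le_sin_mul a ((2 * r + 1) * s) ha0 ha1 (by positivity) (by nlinarith)
  rw [← mul_assoc, han] at hsin
  have hdiff : Real.cos ((2 * r + 1 - 2 * (k + 1 : ℕ)) * s) - Real.cos ((2 * r + 1 - 2 * k) * s)
      = 2 * (Real.sin ((2 * r - 2 * k) * s) * Real.sin s) := by
    push_cast
    rw [show (2 * (r : ℝ) + 1 - 2 * (k + 1)) * s = (2 * r - 2 * k) * s - s by ring,
      show (2 * (r : ℝ) + 1 - 2 * k) * s = (2 * r - 2 * k) * s + s by ring,
      Real.cos_sub, Real.cos_add]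
    ring
  have hfrac : (2 * r + 1 - 2 * (k + 1 : ℕ)) / (2 * (r : ℝ) + 1)
      + (2 * r + 1 - 2 * k) / (2 * r + 1) = 2 * a := by
    rw [ha]
    push_cast
    ring
  have hlow : a * Real.cos ((2 * r + 1) * s)
      ≤ Real.sin ((2 * r - 2 * k) * s) * Real.sin s := by
    nlinarith [mul_le_mul_of_nonneg_left hCS ha0, mul_le_mul_of_nonneg_right hsin hσ.le]
  have haC := mul_nonneg ha0 hC.le
  rw [pow_succ]
  generalize Real.cos ((2 * r + 1) * s) = C at *
  generalize (2 * r + 1 - 2 * (k + 1 : ℕ)) / (2 * (r : ℝ) + 1) = p at *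
  generalize (2 * r + 1 - 2 * k) / (2 * (r : ℝ) + 1) = q at *
  have hpq : p * C + q * C = 2 * (a * C) := by rw [← add_mul, hfrac, mul_assoc]
  rcases neg_one_pow_eq_or ℝ k with h | h <;> rw [h] <;> linarith

theorem stmt19 (N : ℕ) (hN : 4 ≤ N) (hNeven : Even N)
    (ν : ℝ) (hν0 : 0 < ν) (hνroot : Ucheb' (N + 1) ν = 0)
    (hνleast : ∀ x : ℝ, 0 < x → x < ν → Ucheb' (N + 1) x ≠ 0)
    (z : ℕ → ℝ) (hz : ∀ k : ℕ, 1 ≤ k → k ≤ N → z k = zCoord N k ν)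
    (β2 : ℝ)
    (hβ2 : β2 = ∑ j ∈ Finset.Icc 1 N, z j ^ 2 - ∑ j ∈ Finset.Icc 1 (N - 2), z j * z (j + 2))
    (α : ℕ → ℝ)
    (hα : ∀ k : ℕ, 1 ≤ k → k ≤ N - 2 →
      α k = (∑ j ∈ Finset.Icc 1 (N - k + 1), z j * z (j + k - 1)
              - ∑ j ∈ Finset.Icc 1 (N - k - 1), z j * z (j + k + 1)) / β2)
    (hαN1 : α (N - 1) = (z 1 * z (N - 1) + z 2 * z N) / β2)
    (hαN : α N = z 1 * z N / β2) :
    ∀ k : ℕ, 1 ≤ k → k ≤ N → 0 < α k := by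
  obtain ⟨r, hr⟩ := hNeven
  obtain rfl : N = 2 * r := by omega
  have hr2 : 2 ≤ r := by omega
  push_cast at hνroot hνleast
  obtain ⟨s, hs0, hs, rfl⟩ := exists_eq_sin_of_least_root r (by omega) ν hν0 hνleast
  have hroot : 2 * (r + 1) * Real.cos (2 * (r + 1) * s) * Real.cos s
      + Real.sin (2 * (r + 1) * s) * Real.sin s = 0 := by
    have h := Ucheb'_sin_mul_cos_pow r s
    rw [hνroot, zero_mul] at h
    exact (mul_eq_zero.1 h.symm).resolve_left (by simp)
  have key := fun (k : ℕ) (h1 : 1 ≤ k) (h2 : k ≤ 2 * r) =>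
    autocorrelation_sub_pos z (2 * r) r k rfl h1 h2
      (fun i hi1 hi2 => by
        rw [hz _ (by omega) (by omega), hz i hi1 hi2]
        exact zCoord_reflect _ _ (even_two_mul r) hi1 hi2 _)
      (by
        rw [hz 1 le_rfl (by omega)]
        exact zCoord_one_pos r hr2 s hs0 hs hroot)
      (fun i hi1 hi2 => by
        rw [hz i hi1 (by omega), hz (i + 1) (by omega) (by omega)]
        exact zCoord_le_succ r hr2 s hs0 hs hroot i hi1 hi2)
  have hβ : 0 < β2 := by
    have h := key 1 le_rfl (by omega)
    rw [Nat.sub_add_cancel (by omega), Nat.sub_sub] at h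
    simpa [hβ2, sq, add_assoc] using h
  intro k h1 h2
  have hk := key k h1 h2
  rcases (by omega : k ≤ 2 * r - 2 ∨ k = 2 * r - 1 ∨ k = 2 * r) with h | h | h
  · rw [hα k h1 h]
    exact div_pos hk hβ
  · subst h
    rw [hαN1]
    refine div_pos ?_ hβ
    rw [show 2 * r - (2 * r - 1) + 1 = 2 by omega,
      show 2 * r - (2 * r - 1) - 1 = 0 by omega] at hk
    simpa [Finset.sum_Icc_succ_top, show 1 + (2 * r - 1) - 1 = 2 * r - 1 by omega,
      show 2 + (2 * r - 1) - 1 = 2 * r by omega] using hk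
  · subst h
    rw [hαN]
    refine div_pos ?_ hβ
    simpa using hk
end
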